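/- arXiv:math/0307147 — 2 statements merged into one kernel-verified Lean document; each statement's English description precedes it below -/
import Mathlib

section
/- The number c^n_{λμ} of factorizations of a fixed n-cycle in S_n as a product of a permutation of cycle type λ and a permutation of cycle type μ is given by c^n_{λμ} = (n / (z_λ z_μ)) · Σ_{r=0}^{n-1} (-1)^r · r! · (n-1-r)! · χ^{(n-r,1^r)}(λ) · χ^{(n-r,1^r)}(μ). -/
open Equiv Finset MvPolynomial

/-- `σ` has cycle type `lam` (cycle lengths including fixed points). -/
def hasCycleType {n : ℕ} (σ : Perm (Fin n)) (lam : n.Partition) : Prop :=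
  σ.partition.parts = lam.parts

/-- number of pairs `(α, β)` with cycle types `lam`, `mu` and `α * β = σ`. -/
noncomputable def numFactorizations (n : ℕ) (lam mu : n.Partition) (σ : Perm (Fin n)) : ℕ :=
  Nat.card {p : Perm (Fin n) × Perm (Fin n) //
    hasCycleType p.1 lam ∧ hasCycleType p.2 mu ∧ p.1 * p.2 = σ}

/-- `z_λ = ∏ i, α_i! i^{α_i}`, the order of the centralizer. -/
def zPart {n : ℕ} (lam : n.Partition) : ℕ :=
  ∏ i ∈ Finset.range (n + 1),
    (Nat.factorial (Multiset.count i lam.parts)) * i ^ (Multiset.count i lam.parts)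

/-- The irreducible character `χ^ρ` of `S_n` evaluated at class `μ`, via the
Frobenius character formula: the coefficient of `x^{ρ + δ}` in `a_δ ⬝ p_μ`. -/
noncomputable def charSn (n : ℕ) (ρ μ : n.Partition) : ℤ :=
  MvPolynomial.coeff
    (Finsupp.equivFunOnFinite.symm fun i : Fin n =>
      ((ρ.parts.sort (· ≤ ·)).reverse.getD i 0) + (n - 1 - (i : ℕ)))
    ((∏ i : Fin n, ∏ j ∈ Finset.univ.filter (fun j => i < j),
        (X i - X j : MvPolynomial (Fin n) ℤ)) *
      (μ.parts.map (fun k => ∑ j : Fin n, (X j : MvPolynomial (Fin n) ℤ) ^ k)).prod)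

/-- The hook partition `(n-r, 1^r)` of `n`. -/
def hookPartition (n r : ℕ) (h : r < n) : n.Partition :=
  ⟨(n - r) ::ₘ Multiset.replicate r 1, by
    intro i hi
    rcases Multiset.mem_cons.mp hi with h1 | h1
    · omega
    · simp [Multiset.eq_of_mem_replicate h1],
   by simp [Multiset.sum_replicate]; omega⟩

/-- The partition `1^n` of `n`. -/
def onesPartition (n : ℕ) : n.Partition :=
  ⟨Multiset.replicate n 1, by
    intro i hi
    simp [Multiset.eq_of_mem_replicate hi], by simp⟩

/-- The exponent vector `δ + m e_r`, where `δ = (n - 1, …, 1, 0)`. -/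
noncomputable def deltaAdd {n : ℕ} (m : ℕ) (r : Fin n) : Fin n →₀ ℕ :=
  Finsupp.equivFunOnFinite.symm fun i => (n - 1 - (i : ℕ)) + if i = r then m else 0

lemma deltaAdd_apply {n : ℕ} (m : ℕ) (r i : Fin n) :
    deltaAdd m r i = (n - 1 - (i : ℕ)) + if i = r then m else 0 := rfl

/-- The alternating polynomials in `n` variables. -/
def IsAlternating {n : ℕ} (P : MvPolynomial (Fin n) ℤ) : Prop :=
  ∀ π : Perm (Fin n), rename π P = (Perm.sign π : ℤ) • P

lemma IsAlternating.coeff_comp {n : ℕ} {P : MvPolynomial (Fin n) ℤ} (hP : IsAlternating P)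
    (π : Perm (Fin n)) {v w : Fin n →₀ ℕ} (h : ∀ i, w (π i) = v i) :
    coeff w P = (Perm.sign π : ℤ) * coeff v P := by
  have hw : w = v.mapDomain π := by
    ext i
    obtain ⟨j, rfl⟩ := π.surjective i
    rw [Finsupp.mapDomain_apply π.injective, h]
  have h1 := coeff_rename_mapDomain π π.injective P v
  rw [hP π, ← hw, coeff_smul, smul_eq_mul] at h1
  rw [← h1, ← mul_assoc]
  rcases Int.units_eq_one_or (Perm.sign π) with h | h <;> simp [h]

lemma IsAlternating.coeff_eq_zero {n : ℕ} {P : MvPolynomial (Fin n) ℤ} (hP : IsAlternating P)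
    {i j : Fin n} (hij : i ≠ j) {v : Fin n →₀ ℕ} (h : v i = v j) : coeff v P = 0 := by
  have h1 := hP.coeff_comp (swap i j) (v := v) (w := v) (fun l => by
    rcases eq_or_ne l i with rfl | hi
    · simp [h]
    rcases eq_or_ne l j with rfl | hj
    · simp [h]
    rw [swap_apply_of_ne_of_ne hi hj])
  rw [Perm.sign_swap hij] at h1
  push_cast at h1
  omega

lemma IsAlternating.mul_psum {n : ℕ} {P : MvPolynomial (Fin n) ℤ} (hP : IsAlternating P)
    (k : ℕ) : IsAlternating (P * ∑ j : Fin n, (X j : MvPolynomial (Fin n) ℤ) ^ k) := by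
  intro π
  rw [map_mul, hP π, map_sum, smul_mul_assoc]
  congr 2
  simp only [map_pow, rename_X]
  exact Equiv.sum_comp π (fun j => (X j : MvPolynomial (Fin n) ℤ) ^ k)

lemma IsAlternating.mul_prod_psum {n : ℕ} {P : MvPolynomial (Fin n) ℤ} (hP : IsAlternating P)
    (s : Multiset ℕ) : IsAlternating
      (P * (s.map (fun k => ∑ j : Fin n, (X j : MvPolynomial (Fin n) ℤ) ^ k)).prod) := by
  induction s using Multiset.induction_on with
  | empty => simpa using hP
  | cons k s ih =>
    rw [Multiset.map_cons, Multiset.prod_cons, mul_left_comm, mul_comm]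
    exact ih.mul_psum k

lemma IsAlternating.coeff_deltaAdd_mul_psum {n : ℕ} {P : MvPolynomial (Fin n) ℤ}
    (hP : IsAlternating P) {k m : ℕ} (hk : 0 < k) (hkm : k ≤ m) (r : Fin n) :
    coeff (deltaAdd m r) (P * ∑ j : Fin n, (X j : MvPolynomial (Fin n) ℤ) ^ k) =
      coeff (deltaAdd (m - k) r) P - if h : k ≤ r then
        coeff (deltaAdd (m - k) ⟨r - k, by omega⟩) P else 0 := by
  have hterm : ∀ j : Fin n, coeff (deltaAdd m r) (P * (X j : MvPolynomial (Fin n) ℤ) ^ k) =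
      if k ≤ deltaAdd m r j then coeff (deltaAdd m r - Finsupp.single j k) P else 0 := by
    intro j
    rw [X_pow_eq_monomial, coeff_mul_monomial']
    simp [Finsupp.single_le_iff]
  rw [Finset.mul_sum, coeff_sum]
  simp_rw [hterm]
  have hr : (if k ≤ deltaAdd m r r then coeff (deltaAdd m r - Finsupp.single r k) P else 0) =
      coeff (deltaAdd (m - k) r) P := by
    rw [if_pos (by simp [deltaAdd_apply]; omega)]
    congr 1
    ext i
    rcases eq_or_ne i r with rfl | hi
    · simp [deltaAdd_apply]; omega
    · simp [deltaAdd_apply, hi]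
  have hz : ∀ j : Fin n, j ≠ r → (j : ℕ) + k ≠ r →
      (if k ≤ deltaAdd m r j then coeff (deltaAdd m r - Finsupp.single j k) P else 0) = 0 := by
    intro j hj hjr
    split_ifs with h
    · simp only [deltaAdd_apply, hj, if_false] at h
      have hlt : (j : ℕ) + k < n := by omega
      refine hP.coeff_eq_zero (i := j) (j := ⟨j + k, hlt⟩) (by simp [Fin.ext_iff]; omega) ?_
      have h2 : (⟨j + k, hlt⟩ : Fin n) ≠ r := by simp [Fin.ext_iff]; omega
      have h3 : j ≠ (⟨j + k, hlt⟩ : Fin n) := by simp [Fin.ext_iff]; omega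
      simp [deltaAdd_apply, hj, h2, h3.symm]
      omega
    · rfl
  by_cases h : k ≤ r
  · rw [dif_pos h]
    set s : Fin n := ⟨r - k, by omega⟩ with hs
    have hsr : s ≠ r := by simp [hs, Fin.ext_iff]; omega
    rw [Finset.sum_eq_add_of_mem r s (mem_univ _) (mem_univ _) hsr.symm, hr, sub_eq_add_neg]
    · congr 1
      rw [if_pos (by simp [deltaAdd_apply, hs]; omega)]
      rw [hP.coeff_comp (swap r s) (v := deltaAdd (m - k) s)]
      · simp [Perm.sign_swap hsr.symm]
      · intro i
        rcases eq_or_ne i r with rfl | hi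
        · simp [deltaAdd_apply, hsr, hsr.symm]
          simp [hs]; omega
        rcases eq_or_ne i s with rfl | hi'
        · simp [deltaAdd_apply, hsr.symm]
          simp [hs]; omega
        rw [swap_apply_of_ne_of_ne hi hi']
        simp [deltaAdd_apply, hi, hi']
    · intro j _ hj
      refine hz j hj.1 fun h' => hj.2 ?_
      simp [hs, Fin.ext_iff]; omega
  · rw [dif_neg h, sub_zero, Finset.sum_eq_single r _ (by simp), hr]
    intro j _ hj
    exact hz j hj (by omega)

lemma prod_sub_eq_det_vandermonde {n : ℕ} {R : Type*} [CommRing R] (v : Fin n → R) :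
    (∏ i : Fin n, ∏ j ∈ Finset.univ.filter (fun j => i < j), (v i - v j)) =
      (Matrix.vandermonde (fun i => v i.rev)).det := by
  rw [Matrix.det_vandermonde]
  rw [Finset.prod_sigma', Finset.prod_sigma']
  refine Finset.prod_bij' (fun x _ => ⟨x.2.rev, x.1.rev⟩) (fun x _ => ⟨x.2.rev, x.1.rev⟩)
    ?_ ?_ ?_ ?_ ?_
    <;> simp

lemma isAlternating_prod_sub (n : ℕ) : IsAlternating
    (∏ i : Fin n, ∏ j ∈ Finset.univ.filter (fun j => i < j),
        (X i - X j : MvPolynomial (Fin n) ℤ)) := by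
  intro π
  have h : rename π (∏ i : Fin n, ∏ j ∈ Finset.univ.filter (fun j => i < j),
        (X i - X j : MvPolynomial (Fin n) ℤ)) =
      ∏ i : Fin n, ∏ j ∈ Finset.univ.filter (fun j => i < j),
        (X (π i) - X (π j) : MvPolynomial (Fin n) ℤ) := by
    simp [map_prod]
  rw [h, prod_sub_eq_det_vandermonde (fun i => (X (π i) : MvPolynomial (Fin n) ℤ)),
    prod_sub_eq_det_vandermonde (fun i => (X i : MvPolynomial (Fin n) ℤ))]
  have h2 := Matrix.det_permute (Fin.revPerm.trans (π.trans Fin.revPerm))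
    (Matrix.vandermonde (fun i : Fin n => (X i.rev : MvPolynomial (Fin n) ℤ)))
  have h3 : Perm.sign ((Fin.revPerm : Perm (Fin n)).trans (π.trans Fin.revPerm)) =
      Perm.sign π := by
    have := Perm.sign_symm_trans_trans π (Fin.revPerm : Perm (Fin n))
    simpa [mul_assoc] using this
  rw [h3] at h2
  rw [zsmul_eq_mul, ← h2]
  congr 1
  ext i j
  simp [Matrix.vandermonde_apply]

lemma coeff_deltaAdd_zero_prod_sub {n : ℕ} (r : Fin n) :
    coeff (deltaAdd 0 r) (∏ i : Fin n, ∏ j ∈ Finset.univ.filter (fun j => i < j),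
        (X i - X j : MvPolynomial (Fin n) ℤ)) = 1 := by
  rw [prod_sub_eq_det_vandermonde (fun i => (X i : MvPolynomial (Fin n) ℤ)), Matrix.det_apply,
    coeff_sum]
  have hmon : ∀ w : Perm (Fin n), ∏ i, Matrix.vandermonde
      (fun i : Fin n => (X i.rev : MvPolynomial (Fin n) ℤ)) (w i) i =
      monomial (∑ i, Finsupp.single (w i).rev (i : ℕ)) 1 := by
    intro w
    rw [monomial_sum_one]
    simp [Matrix.vandermonde_apply, X_pow_eq_monomial]
  have hexp : ∀ w : Perm (Fin n),
      ∑ i, Finsupp.single (w i).rev (i : ℕ) = deltaAdd 0 r ↔ w = 1 := by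
    intro w
    have hval : ∀ i, (∑ i, Finsupp.single (w i).rev (i : ℕ)) (w i).rev = (i : ℕ) := by
      intro i
      rw [Finsupp.finsetSum_apply, Finset.sum_eq_single i]
      · simp
      · intro j _ hj
        simp [hj]
      · simp
    constructor
    · intro h
      ext i
      have h1 := hval i
      rw [h] at h1
      simp [deltaAdd_apply] at h1
      simp only [Perm.one_apply]
      omega
    · rintro rfl
      ext i
      have h1 := hval i.rev
      simp only [Perm.one_apply, Fin.rev_rev] at h1 ⊢
      rw [h1]
      simp [deltaAdd_apply]
      omega
  simp_rw [hmon, coeff_smul, coeff_monomial, hexp]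
  simp

lemma coeff_deltaAdd_prod_psum {n : ℕ} (s : Multiset ℕ) (hs : ∀ k ∈ s, 0 < k) (r : Fin n) :
    coeff (deltaAdd s.sum r) ((∏ i : Fin n, ∏ j ∈ Finset.univ.filter (fun j => i < j),
        (X i - X j : MvPolynomial (Fin n) ℤ)) *
      (s.map (fun k => ∑ j : Fin n, (X j : MvPolynomial (Fin n) ℤ) ^ k)).prod) =
    PowerSeries.coeff (r : ℕ)
      ((s.map (fun k => (1 - PowerSeries.X ^ k : PowerSeries ℤ))).prod *
        PowerSeries.mk fun _ => 1) := by
  induction s using Multiset.induction_on generalizing r with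
  | empty => simpa using coeff_deltaAdd_zero_prod_sub r
  | cons k s ih =>
    have ih' := ih (fun l hl => hs l (Multiset.mem_cons_of_mem hl))
    rw [Multiset.map_cons, Multiset.prod_cons, mul_left_comm, mul_comm,
      ((isAlternating_prod_sub n).mul_prod_psum s).coeff_deltaAdd_mul_psum
        (hs k (Multiset.mem_cons_self k s)) (by simp)]
    rw [Multiset.map_cons, Multiset.prod_cons, mul_assoc, sub_mul, one_mul, map_sub,
      PowerSeries.coeff_X_pow_mul']
    simp only [Multiset.sum_cons, Nat.add_sub_cancel_left, ih']
    simp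

lemma sort_hookPartition_parts (n r : ℕ) (h : r < n) :
    ((hookPartition n r h).parts.sort (· ≤ ·)).reverse = (n - r) :: List.replicate r 1 := by
  rw [List.reverse_eq_iff]
  refine List.Perm.eq_of_pairwise' (r := (· ≤ ·)) (Multiset.pairwise_sort _ _) ?_ ?_
  · simp [List.pairwise_append, List.pairwise_replicate]
    omega
  · rw [← Multiset.coe_eq_coe, Multiset.sort_eq]
    rw [List.reverse_cons, List.reverse_replicate, ← Multiset.coe_add, add_comm,
      Multiset.coe_singleton, Multiset.singleton_add, Multiset.coe_replicate]
    rfl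

lemma charSn_hookPartition (n r : ℕ) (h : r < n) (mu : n.Partition) :
    charSn n (hookPartition n r h) mu = (-1) ^ r * PowerSeries.coeff r
      ((mu.parts.map (fun k => (1 - PowerSeries.X ^ k : PowerSeries ℤ))).prod *
        PowerSeries.mk fun _ => 1) := by
  have h1 := coeff_deltaAdd_prod_psum mu.parts (fun k hk => mu.parts_pos hk) ⟨r, h⟩
  rw [mu.parts_sum] at h1
  simp only at h1
  rw [← h1, charSn, sort_hookPartition_parts]
  have : NeZero n := ⟨by omega⟩
  rw [((isAlternating_prod_sub n).mul_prod_psum mu.parts).coeff_comp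
    (Fin.cycleRange ⟨r, h⟩) (v := deltaAdd n ⟨r, h⟩)]
  · simp [Fin.sign_cycleRange]
  · intro i
    simp only [Finsupp.equivFunOnFinite_symm_apply_apply, deltaAdd_apply]
    rcases lt_trichotomy (i : ℕ) r with hi | hi | hi
    · have hc : (Fin.cycleRange ⟨r, h⟩ i : ℕ) = i + 1 :=
        Fin.coe_cycleRange_of_lt (Fin.lt_def.mpr hi)
      have hne : i ≠ ⟨r, h⟩ := by simp [Fin.ext_iff]; omega
      rw [hc]
      simp [hne, hi]
      omega
    · have hi' : i = ⟨r, h⟩ := Fin.ext hi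
      rw [Fin.cycleRange_of_eq hi', hi']
      simp
      omega
    · have hne : i ≠ ⟨r, h⟩ := by simp [Fin.ext_iff]; omega
      rw [Fin.cycleRange_of_gt (Fin.lt_def.mpr hi), List.getD_eq_default _ _ (by simp; omega)]
      simp [hne]

section SignOn

variable {α : Type*} [Fintype α] [DecidableEq α]

/-- The sign of the restriction of `g` to `T` if `g` preserves `T`, and `0` otherwise. -/
def signOn (T : Finset α) (g : Perm α) : ℤ :=
  if h : ∀ x, g x ∈ T ↔ x ∈ T then (Perm.sign (g.subtypePerm h) : ℤ) else 0

lemma signOn_of_not {T : Finset α} {g : Perm α} (h : ¬ ∀ x, g x ∈ T ↔ x ∈ T) :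
    signOn T g = 0 := dif_neg h

lemma signOn_eq_sign {T : Finset α} {g w : Perm α} (h : ∀ x, g x ∈ T ↔ x ∈ T)
    (h1 : ∀ x ∈ T, w x = g x) (h2 : ∀ x ∉ T, w x = x) : signOn T g = Perm.sign w := by
  have hw : ∀ x, w x ∈ T ↔ x ∈ T := by
    intro x
    by_cases hx : x ∈ T
    · rw [h1 x hx, h]
    · rw [h2 x hx]
  rw [signOn, dif_pos h,
    ← Perm.sign_subtypePerm w hw (fun x hx => by_contra fun h' => hx (h2 x h'))]
  have hgw : g.subtypePerm h = w.subtypePerm hw :=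
    Equiv.ext fun x => Subtype.ext (h1 x x.2).symm
  rw [hgw]
  congr!

omit [Fintype α] in
lemma exists_restriction {T : Finset α} {g : Perm α} (h : ∀ x, g x ∈ T ↔ x ∈ T) :
    ∃ w : Perm α, (∀ x ∈ T, w x = g x) ∧ ∀ x ∉ T, w x = x :=
  ⟨Perm.ofSubtype (g.subtypePerm h),
    fun x hx => by rw [Perm.ofSubtype_apply_of_mem _ hx]; simp,
    fun x hx => Perm.ofSubtype_apply_of_not_mem _ hx⟩

lemma signOn_eq_one {T : Finset α} {g : Perm α} (h : ∀ x ∈ T, g x = x) : signOn T g = 1 := by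
  rw [signOn_eq_sign (w := 1)]
  · simp
  · intro x
    constructor
    · intro hx
      have := h _ hx
      rwa [g.injective this] at hx
    · intro hx
      rwa [h x hx]
  · intro x hx
    simp [h x hx]
  · simp

lemma signOn_one (T : Finset α) : signOn T 1 = 1 := signOn_eq_one (by simp)

lemma signOn_mul_right {T : Finset α} (g : Perm α) {k : Perm α} (h : ∀ x, k x ∈ T ↔ x ∈ T) :
    signOn T (g * k) = signOn T g * signOn T k := by
  by_cases hg : ∀ x, g x ∈ T ↔ x ∈ T
  · have hgk : ∀ x, (g * k) x ∈ T ↔ x ∈ T := fun x => by rw [Perm.mul_apply, hg, h]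
    simp only [signOn, dif_pos hg, dif_pos h, dif_pos hgk]
    rw [← Units.val_mul, ← Perm.sign_mul, Perm.subtypePerm_mul]
  · rw [signOn_of_not hg, zero_mul, signOn_of_not]
    intro h'
    apply hg
    intro x
    have h1 := h' (k⁻¹ x)
    have h2 := h (k⁻¹ x)
    simp at h1 h2
    rw [h1, h2]

lemma signOn_inv (T : Finset α) (g : Perm α) : signOn T g⁻¹ = signOn T g := by
  have key : ∀ k : Perm α, (∀ x, k x ∈ T ↔ x ∈ T) → ∀ x, k⁻¹ x ∈ T ↔ x ∈ T := by
    intro k hk x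
    have := hk (k⁻¹ x)
    simpa using this.symm
  by_cases hg : ∀ x, g x ∈ T ↔ x ∈ T
  · have h := signOn_mul_right g⁻¹ hg
    rw [inv_mul_cancel, signOn_one] at h
    rcases Int.eq_one_or_neg_one_of_mul_eq_one' h.symm with h | h <;> rw [h.1, h.2]
  · rw [signOn_of_not hg, signOn_of_not]
    intro h
    exact hg (by simpa using key _ h)

lemma signOn_mul_left {T : Finset α} {g : Perm α} (h : ∀ x, g x ∈ T ↔ x ∈ T) (k : Perm α) :
    signOn T (g * k) = signOn T g * signOn T k := by
  rw [← signOn_inv, mul_inv_rev, signOn_mul_right, signOn_inv, signOn_inv, mul_comm]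
  intro x
  have := h (g⁻¹ x)
  simpa using this.symm

omit [Fintype α] in
lemma swap_apply_mem_iff {T : Finset α} {x y : α} (h : x ∈ T ↔ y ∈ T) (z : α) :
    swap x y z ∈ T ↔ z ∈ T := by
  rcases eq_or_ne z x with rfl | hx
  · simp [h]
  rcases eq_or_ne z y with rfl | hy
  · simp [h]
  rw [swap_apply_of_ne_of_ne hx hy]

lemma signOn_swap_mem {T : Finset α} {x y : α} (hx : x ∈ T) (hy : y ∈ T) (hxy : x ≠ y) :
    signOn T (swap x y) = -1 := by
  rw [signOn_eq_sign (w := swap x y) (swap_apply_mem_iff (by simp [hx, hy])) (fun _ _ => rfl),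
    Perm.sign_swap hxy]
  · simp
  · rintro z hz
    exact swap_apply_of_ne_of_ne (by grind) (by grind)

lemma signOn_swap_notMem {T : Finset α} {x y : α} (hx : x ∉ T) (hy : y ∉ T) :
    signOn T (swap x y) = 1 :=
  signOn_eq_one fun z hz => swap_apply_of_ne_of_ne (by grind) (by grind)

lemma signOn_swap_eq_zero {T : Finset α} {x y : α} (hx : x ∉ T) (hy : y ∈ T) :
    signOn T (swap x y) = 0 := by
  refine signOn_of_not fun h => hx ?_
  simpa [hy] using h y

lemma signOn_union {S T : Finset α} {g : Perm α} (hST : _root_.Disjoint S T)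
    (hS : ∀ x, g x ∈ S ↔ x ∈ S) (hT : ∀ x, g x ∈ T ↔ x ∈ T) :
    signOn (S ∪ T) g = signOn S g * signOn T g := by
  obtain ⟨u, hu1, hu2⟩ := exists_restriction hS
  obtain ⟨v, hv1, hv2⟩ := exists_restriction hT
  rw [Finset.disjoint_left] at hST
  rw [signOn_eq_sign hS hu1 hu2, signOn_eq_sign hT hv1 hv2, signOn_eq_sign (w := u * v)]
  · simp
  · simp [hS, hT]
  · intro x hx
    rw [Perm.mul_apply]
    rcases Finset.mem_union.mp hx with hx | hx
    · rw [hv2 x (hST hx), hu1 x hx]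
    · rw [hv1 x hx, hu2]
      exact fun h => hST h ((hT x).2 hx)
  · intro x hx
    simp only [Finset.mem_union, not_or] at hx
    rw [Perm.mul_apply, hv2 x hx.2, hu2 x hx.1]

lemma signOn_compl (T : Finset α) (g : Perm α) : signOn Tᶜ g = Perm.sign g * signOn T g := by
  by_cases h : ∀ x, g x ∈ T ↔ x ∈ T
  · have hc : ∀ x, g x ∈ Tᶜ ↔ x ∈ Tᶜ := fun x => by simp [h x]
    have h1 := signOn_union disjoint_compl_right h hc
    rw [Finset.union_compl, signOn_eq_sign (w := g) (by simp) (by simp) (by simp)] at h1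
    obtain ⟨w, hw1, hw2⟩ := exists_restriction h
    rw [h1, signOn_eq_sign h hw1 hw2]
    rcases Int.units_eq_one_or (Perm.sign w) with h | h <;> simp [h]
  · rw [signOn_of_not h, signOn_of_not, mul_zero]
    intro h'
    exact h fun x => by simpa [not_iff_not] using h' x

lemma signOn_conj (T : Finset α) (x g : Perm α) :
    signOn T (x⁻¹ * g * x) = signOn (T.map x.toEmbedding) g := by
  have hmem : ∀ y, x y ∈ T.map x.toEmbedding ↔ y ∈ T := by simp
  have hiff : (∀ y, (x⁻¹ * g * x) y ∈ T ↔ y ∈ T) ↔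
      ∀ y, g y ∈ T.map x.toEmbedding ↔ y ∈ T.map x.toEmbedding := by
    constructor
    · intro h y
      obtain ⟨z, rfl⟩ := x.surjective y
      rw [hmem, ← h z, ← hmem]
      simp
    · intro h z
      rw [← hmem, ← hmem z, ← h (x z)]
      simp
  by_cases h : ∀ y, (x⁻¹ * g * x) y ∈ T ↔ y ∈ T
  · obtain ⟨w, hw1, hw2⟩ := exists_restriction h
    rw [signOn_eq_sign h hw1 hw2, signOn_eq_sign (w := x * w * x⁻¹) (hiff.1 h)]
    · rcases Int.units_eq_one_or (Perm.sign x) with h | h <;> simp [h]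
    · intro y hy
      obtain ⟨z, rfl⟩ := x.surjective y
      rw [hmem] at hy
      simp [hw1 z hy]
    · intro y hy
      obtain ⟨z, rfl⟩ := x.surjective y
      rw [hmem] at hy
      simp [hw2 z hy]
  · rw [signOn_of_not h, signOn_of_not (fun h' => h (hiff.2 h'))]

/-- The symmetries of a Young symmetrizer of hook shape: invariance under the row group
`Perm Tᶜ` on the left, and sign-invariance under the column group `Perm (insert z T)` on the
right. -/
structure IsHookSymmetric (T : Finset α) (z : α) (F : Perm α → ℤ) : Prop where
  swap_mul : ∀ x y g, x ∉ T → y ∉ T → F (swap x y * g) = F g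
  mul_swap : ∀ x y g, x ∈ insert z T → y ∈ insert z T → x ≠ y → F (g * swap x y) = -F g

lemma IsHookSymmetric.eq_zero {T : Finset α} {z : α} (hz : z ∉ T) {F : Perm α → ℤ}
    (hF : IsHookSymmetric T z F) (h1 : F 1 = 0) (g : Perm α) : F g = 0 := by
  induction hk : #g.support using Nat.strong_induction_on generalizing g with
  | _ k ih =>
  subst hk
  by_cases hg : ∃ x, g x ≠ x
  swap
  · push Not at hg
    rwa [show g = 1 from Perm.ext hg]
  by_cases hA : ∃ x, g x ≠ x ∧ x ∉ T ∧ g x ∉ T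
  · obtain ⟨x, hx, hxT, hgT⟩ := hA
    rw [← hF.swap_mul x (g x) g hxT hgT]
    exact ih _ (Perm.card_support_swap_mul hx) _ rfl
  by_cases hB : ∃ x, g x ≠ x ∧ x ∈ insert z T ∧ g x ∈ insert z T
  · obtain ⟨x, hx, hxT, hgT⟩ := hB
    have h2 := hF.mul_swap x (g x) g hxT hgT hx.symm
    have h3 : F (g * swap x (g x)) = 0 := by
      refine ih _ ?_ _ rfl
      have h4 : (g * swap x (g x))⁻¹ = swap (g x) (g⁻¹ (g x)) * g⁻¹ := by
        simp [swap_comm]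
      rw [← Perm.support_inv (g * _), h4, ← Perm.support_inv g]
      refine Perm.card_support_swap_mul ?_
      simpa using hx.symm
    omega
  push Not at hA hB
  obtain ⟨x, hx⟩ := hg
  have hgz : g z = z := by
    by_contra h
    exact hB z h (by simp) (Finset.mem_insert_of_mem (hA z h hz))
  have key : ∀ y ∈ T, g y ≠ y → F g = 0 := by
    intro y hy hgy
    have hgyT : g y ∉ T := fun h =>
      hB y hgy (Finset.mem_insert_of_mem hy) (Finset.mem_insert_of_mem h)
    have h2 := hF.swap_mul (g y) (g z) g hgyT (by rwa [hgz])
    rw [← Equiv.mul_swap_eq_swap_mul, hF.mul_swap y z g (Finset.mem_insert_of_mem hy)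
      (by simp) (by grind)] at h2
    omega
  by_cases hxT : x ∈ T
  · exact key x hxT hx
  · exact key (g x) (hA x hx hxT) (fun h => hx (g.injective h))

/-- The Young symmetrizer of hook shape attached to `(T, z)`, normalized by its value `1` at the
identity. -/
def hookSymmetrizer (T : Finset α) (z : α) (g : Perm α) : ℤ :=
  signOn T g - ∑ b ∈ T, signOn T (g * swap z b)

lemma hookSymmetrizer_one {T : Finset α} {z : α} (hz : z ∉ T) : hookSymmetrizer T z 1 = 1 := by
  rw [hookSymmetrizer, signOn_one, Finset.sum_eq_zero, sub_zero]
  intro b hb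
  rw [one_mul, signOn_swap_eq_zero hz hb]

lemma isHookSymmetric_hookSymmetrizer {T : Finset α} {z : α} (hz : z ∉ T) :
    IsHookSymmetric T z (hookSymmetrizer T z) where
  swap_mul x y g hx hy := by
    have h : ∀ k, signOn T (swap x y * k) = signOn T k := fun k => by
      rw [signOn_mul_left (swap_apply_mem_iff (by simp [hx, hy])), signOn_swap_notMem hx hy,
        one_mul]
    simp only [hookSymmetrizer, mul_assoc, h]
  mul_swap := by
    have hT : ∀ (k : Perm α) {x y : α}, x ∈ T → y ∈ T → x ≠ y →
        signOn T (k * swap x y) = -signOn T k := fun k x y hx hy hxy => by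
      rw [signOn_mul_right _ (swap_apply_mem_iff (by simp [hx, hy])), signOn_swap_mem hx hy hxy,
        mul_neg_one]
    have hzT : ∀ (g : Perm α) {y : α}, y ∈ T →
        hookSymmetrizer T z (g * swap z y) = -hookSymmetrizer T z g := fun g y hy => by
      rw [hookSymmetrizer, hookSymmetrizer, ← Finset.add_sum_erase T _ hy,
        ← Finset.add_sum_erase T _ hy, mul_assoc, swap_mul_self, mul_one]
      have h : ∑ b ∈ T.erase y, signOn T (g * swap z y * swap z b) =
          -∑ b ∈ T.erase y, signOn T (g * swap z b) := by
        rw [← Finset.sum_neg_distrib]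
        refine Finset.sum_congr rfl fun b hb => ?_
        obtain ⟨hby, hbT⟩ := Finset.mem_erase.mp hb
        have hzb : z ≠ b := fun h => hz (h ▸ hbT)
        have hzy : z ≠ y := fun h => hz (h ▸ hy)
        rw [← hT _ hbT hy hby, mul_assoc, mul_assoc]
        congr 2
        rw [mul_swap_eq_swap_mul (swap z b), swap_apply_right,
          swap_apply_of_ne_of_ne hzy.symm hby.symm]
      rw [h]
      ring
    intro x y g hx hy hxy
    rcases Finset.mem_insert.mp hx with rfl | hxT
    · exact hzT g ((Finset.mem_insert.mp hy).resolve_left hxy.symm)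
    rcases Finset.mem_insert.mp hy with rfl | hyT
    · rw [swap_comm]
      exact hzT g hxT
    have h : ∑ b ∈ T, signOn T (g * swap x y * swap z b) =
        -∑ b ∈ T, signOn T (g * swap z b) := by
      rw [← Finset.sum_neg_distrib]
      refine Finset.sum_equiv (swap x y)
        (fun b => (swap_apply_mem_iff (by simp [hxT, hyT]) b).symm) fun b _ => ?_
      rw [← hT _ hxT hyT hxy, mul_assoc, mul_assoc, mul_swap_eq_swap_mul (swap x y) z b,
        swap_apply_of_ne_of_ne (a := x) (b := y) (x := z) (by grind) (by grind)]
    rw [hookSymmetrizer, hookSymmetrizer, hT g hxT hyT hxy, h]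
    ring

lemma IsHookSymmetric.eq_mul_hookSymmetrizer {T : Finset α} {z : α} (hz : z ∉ T)
    {F : Perm α → ℤ} (hF : IsHookSymmetric T z F) (g : Perm α) :
    F g = F 1 * hookSymmetrizer T z g := by
  have hf := isHookSymmetric_hookSymmetrizer hz
  have h : IsHookSymmetric T z (fun g => F g - F 1 * hookSymmetrizer T z g) :=
    { swap_mul := fun x y g hx hy => by
        simp only [hF.swap_mul x y g hx hy, hf.swap_mul x y g hx hy]
      mul_swap := fun x y g hx hy hxy => by
        simp only [hF.mul_swap x y g hx hy hxy, hf.mul_swap x y g hx hy hxy]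
        ring }
  have := h.eq_zero hz (by simp [hookSymmetrizer_one hz]) g
  linarith

lemma hookSymmetrizer_erase {T : Finset α} {b : α} (hb : b ∈ T) (g : Perm α) :
    hookSymmetrizer (T.erase b) b g = signOn T g + ∑ a ∈ Tᶜ, signOn T (swap a b * g) := by
  have hbc : b ∉ Tᶜ := by simpa using hb
  have hf := isHookSymmetric_hookSymmetrizer hbc
  have hins : ∀ x ∉ T.erase b, x ∈ insert b Tᶜ := fun x hx => by
    simp only [Finset.mem_insert, Finset.mem_compl, Finset.mem_erase] at *
    tauto
  have h : IsHookSymmetric (T.erase b) b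
      (fun g => (Perm.sign g : ℤ) * hookSymmetrizer Tᶜ b g⁻¹) :=
    { swap_mul := fun x y g hx hy => by
        rcases eq_or_ne x y with rfl | hxy
        · rw [swap_self, ← Perm.one_def, one_mul]
        have := hf.mul_swap x y g⁻¹ (hins x hx) (hins y hy) hxy
        rw [mul_inv_rev, swap_inv, this, Perm.sign_mul, Perm.sign_swap hxy]
        push_cast
        ring
      mul_swap := fun x y g hx hy hxy => by
        rw [Finset.insert_erase hb] at hx hy
        have := hf.swap_mul x y g⁻¹ (by simpa using hx) (by simpa using hy)
        rw [mul_inv_rev, swap_inv, this, Perm.sign_mul, Perm.sign_swap hxy]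
        push_cast
        ring }
  have h1 := h.eq_mul_hookSymmetrizer (by simp) g
  simp only [inv_one, hookSymmetrizer_one hbc, Perm.sign_one, Units.val_one, one_mul] at h1
  rw [← h1, hookSymmetrizer, mul_sub, signOn_compl, signOn_inv, Perm.sign_inv, ← mul_assoc,
    Finset.mul_sum, sub_eq_add_neg, ← Finset.sum_neg_distrib]
  congr 1
  · rcases Int.units_eq_one_or (Perm.sign g) with h | h <;> simp [h]
  · refine Finset.sum_congr rfl fun a ha => ?_
    have hab : a ≠ b := fun h => hbc (h ▸ ha)
    have : g⁻¹ * swap b a = (swap a b * g)⁻¹ := by simp [swap_comm]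
    rw [this, signOn_inv, signOn_compl, Perm.sign_mul, Perm.sign_swap hab]
    rcases Int.units_eq_one_or (Perm.sign g) with h | h <;> simp [h]

/-- The sum of a function over all conjugates of its argument. -/
def conjSum (f : Perm α → ℤ) (g : Perm α) : ℤ := ∑ x : Perm α, f (x⁻¹ * g * x)

lemma conjSum_one (f : Perm α → ℤ) : conjSum f 1 = (Fintype.card α).factorial * f 1 := by
  simp [conjSum, Fintype.card_perm]

lemma conjSum_mul_left (f : Perm α → ℤ) {y g : Perm α} :
    conjSum (fun h => f (y⁻¹ * h * y)) g = conjSum f g := by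
  rw [conjSum, conjSum, ← Equiv.sum_comp (Equiv.mulRight y) (fun x => f (x⁻¹ * g * x))]
  simp [mul_assoc]

omit [Fintype α] [DecidableEq α] in
lemma sum_conj_eq {C : Finset (Perm α)} (hC : ∀ a ∈ C, ∀ x, x⁻¹ * a * x ∈ C) (x : Perm α)
    (f : Perm α → ℤ) : ∑ a ∈ C, f (x⁻¹ * a * x) = ∑ a ∈ C, f a := by
  refine Finset.sum_bij' (fun a _ => x⁻¹ * a * x) (fun a _ => x * a * x⁻¹) (fun a ha => hC a ha x)
    (fun a ha => by simpa using hC a ha x⁻¹) ?_ ?_ ?_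
  all_goals intros; simp [mul_assoc]

/-- Class sums act by scalars on the conjugation averages of Young symmetrizers of hook shape. -/
lemma sum_conjSum_hookSymmetrizer_mul {T : Finset α} {z : α} (hz : z ∉ T) {C : Finset (Perm α)}
    (hC : ∀ a ∈ C, ∀ x, x⁻¹ * a * x ∈ C) (g : Perm α) :
    (Fintype.card α).factorial * ∑ a ∈ C, conjSum (hookSymmetrizer T z) (a * g) =
      (∑ a ∈ C, conjSum (hookSymmetrizer T z) a) * conjSum (hookSymmetrizer T z) g := by
  set f := hookSymmetrizer T z with hf
  have hsym := isHookSymmetric_hookSymmetrizer hz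
  rw [← hf] at hsym
  have h : IsHookSymmetric T z (fun g => ∑ a ∈ C, f (a * g)) :=
    { swap_mul := fun x y g hx hy => by
        rw [← sum_conj_eq hC (swap x y) (fun a => f (a * (swap x y * g)))]
        refine Finset.sum_congr rfl fun a _ => ?_
        rw [← hsym.swap_mul x y (a * g) hx hy]
        simp [mul_assoc]
      mul_swap := fun x y g hx hy hxy => by
        simp only [← mul_assoc, hsym.mul_swap x y _ hx hy hxy, Finset.sum_neg_distrib] }
  have h1 : ∀ k, ∑ a ∈ C, f (a * k) = (∑ a ∈ C, f a) * f k := fun k => by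
    simpa using h.eq_mul_hookSymmetrizer hz k
  have h2 : ∀ k, ∑ a ∈ C, conjSum f (a * k) = (∑ a ∈ C, f a) * conjSum f k := fun k => by
    simp only [conjSum]
    rw [Finset.sum_comm, Finset.mul_sum]
    refine Finset.sum_congr rfl fun x _ => ?_
    rw [← h1, ← sum_conj_eq hC x (fun a => f (a * (x⁻¹ * k * x)))]
    simp [mul_assoc]
  have h3 : ∑ a ∈ C, conjSum f a = (∑ a ∈ C, f a) * (Fintype.card α).factorial := by
    have := h2 1
    simpa [conjSum_one, hf, hookSymmetrizer_one hz] using this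
  rw [h2, h3]
  ring

lemma conjSum_signOn_mul_swap {T : Finset α} {y z a b : α} (hy : y ∉ T) (hz : z ∉ T)
    (ha : a ∈ T) (hb : b ∈ T) (g : Perm α) :
    conjSum (fun h => signOn T (h * swap y a)) g =
      conjSum (fun h => signOn T (h * swap z b)) g := by
  have hne : ∀ u ∉ T, ∀ v ∈ T, u ≠ v := fun u hu v hv h => hu (h ▸ hv)
  set w := swap y z * swap a b with hw
  have hwT : ∀ x, w x ∈ T ↔ x ∈ T := fun x => by
    rw [hw, Perm.mul_apply, swap_apply_mem_iff (by simp [hy, hz]),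
      swap_apply_mem_iff (by simp [ha, hb])]
  have hwT' : ∀ x, w⁻¹ x ∈ T ↔ x ∈ T := fun x => by
    simpa using (hwT (w⁻¹ x)).symm
  rw [← conjSum_mul_left (y := w)]
  congr 1
  ext h
  have h1 : w⁻¹ * h * w * swap y a = w⁻¹ * (h * swap z b) * w := by
    have hwy : w y = z := by
      rw [hw, Perm.mul_apply, swap_apply_of_ne_of_ne (hne y hy a ha) (hne y hy b hb),
        swap_apply_left]
    have hwa : w a = b := by
      rw [hw, Perm.mul_apply, swap_apply_left,
        swap_apply_of_ne_of_ne (hne y hy b hb).symm (hne z hz b hb).symm]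
    rw [mul_assoc _ w, mul_swap_eq_swap_mul w, hwy, hwa]
    simp only [mul_assoc]
  rw [h1, signOn_mul_right _ hwT, signOn_mul_left hwT', signOn_inv, mul_comm, ← mul_assoc]
  have h2 := signOn_mul_right w⁻¹ hwT
  rw [inv_mul_cancel, signOn_one, signOn_inv] at h2
  rw [← h2, one_mul]

lemma conjSum_signOn_swap_mul (T : Finset α) (a b : α) (g : Perm α) :
    conjSum (fun h => signOn T (swap a b * h)) g =
      conjSum (fun h => signOn T (h * swap a b)) g := by
  rw [← conjSum_mul_left (y := swap a b)]
  simp [mul_assoc]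

lemma conjSum_hookSymmetrizer_add {T : Finset α} {z b : α} (hz : z ∉ T) (hb : b ∈ T)
    (g : Perm α) :
    (Fintype.card α - #T) * conjSum (hookSymmetrizer T z) g +
      #T * conjSum (hookSymmetrizer (T.erase b) b) g =
    Fintype.card α * conjSum (signOn T) g := by
  have h1 : conjSum (hookSymmetrizer T z) g = conjSum (signOn T) g -
      #T * conjSum (fun h => signOn T (h * swap z b)) g := by
    rw [← nsmul_eq_mul, ← Finset.sum_const, ← Finset.sum_congr rfl
      fun a ha => conjSum_signOn_mul_swap hz hz ha hb g]
    simp only [conjSum, hookSymmetrizer]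
    rw [Finset.sum_comm (s := T), Finset.sum_sub_distrib]
  have h2 : conjSum (hookSymmetrizer (T.erase b) b) g = conjSum (signOn T) g +
      #Tᶜ * conjSum (fun h => signOn T (h * swap z b)) g := by
    rw [← nsmul_eq_mul, ← Finset.sum_const, ← Finset.sum_congr rfl
      fun a ha => conjSum_signOn_mul_swap (Finset.mem_compl.mp ha) hz hb hb g]
    simp only [← conjSum_signOn_swap_mul]
    simp only [conjSum, hookSymmetrizer_erase hb]
    rw [Finset.sum_comm (s := Tᶜ), Finset.sum_add_distrib]
  rw [h1, h2, Finset.card_compl, Nat.cast_sub (Finset.card_le_univ T)]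
  ring

lemma choose_mul_conjSum_signOn (T : Finset α) (g : Perm α) :
    (Fintype.card α).choose #T * conjSum (signOn T) g =
      (Fintype.card α).factorial * ∑ S ∈ powersetCard #T (univ : Finset α), signOn S g := by
  have h1 : ∀ S ∈ powersetCard #T (univ : Finset α),
      conjSum (signOn T) g = conjSum (signOn S) g := by
    intro S hS
    have hc : #T = #S := (Finset.mem_powersetCard.mp hS).2.symm
    set e := Finset.equivOfCardEq hc with he
    have hTS : T.map (e.extendSubtype).toEmbedding = S := by
      refine Finset.eq_of_subset_of_card_le ?_ (by simp [hc])
      intro x hx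
      obtain ⟨y, hy, rfl⟩ := Finset.mem_map.mp hx
      exact e.extendSubtype_mem y hy
    rw [← conjSum_mul_left (y := e.extendSubtype)]
    simp only [signOn_conj, hTS]
  rw [← Finset.card_univ, ← Finset.card_powersetCard, ← nsmul_eq_mul, ← Finset.sum_const,
    Finset.sum_congr rfl h1]
  simp only [conjSum]
  rw [Finset.sum_comm, Finset.card_univ, ← Fintype.card_perm, ← Finset.card_univ (α := Perm α),
    ← nsmul_eq_mul, ← Finset.sum_const]
  refine Finset.sum_congr rfl fun x _ => ?_
  simp only [signOn_conj]
  refine Finset.sum_equiv (Equiv.finsetCongr x) (fun S => ?_) (fun S _ => ?_)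
  · simp [Finset.mem_powersetCard]
  · simp

end SignOn

section CycleGenFun

variable {α : Type*} [Fintype α] [DecidableEq α]

/-- The generating function, by cardinality, of the signs of the restrictions of `g` to the
`g`-invariant subsets of `V`. -/
noncomputable def signGenFun (g : Perm α) (V : Finset α) : PowerSeries ℤ :=
  ∑ S ∈ V.powerset, (signOn S g : PowerSeries ℤ) * (-PowerSeries.X) ^ #S

lemma signGenFun_empty (g : Perm α) : signGenFun g ∅ = 1 := by
  simp [signGenFun, signOn_eq_one]

lemma signGenFun_union {g : Perm α} {V W : Finset α} (hVW : _root_.Disjoint V W)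
    (hV : ∀ x, g x ∈ V ↔ x ∈ V) (hW : ∀ x, g x ∈ W ↔ x ∈ W) :
    signGenFun g (V ∪ W) = signGenFun g V * signGenFun g W := by
  have hd : ∀ x ∈ V, x ∉ W := Finset.disjoint_left.mp hVW
  rw [signGenFun, signGenFun, signGenFun, Finset.sum_mul_sum, ← Finset.sum_product']
  symm
  refine Finset.sum_bij' (fun p _ => p.1 ∪ p.2) (fun S _ => (S ∩ V, S ∩ W)) ?_ ?_ ?_ ?_ ?_
  · intro p hp
    rw [Finset.mem_product, Finset.mem_powerset, Finset.mem_powerset] at hp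
    exact Finset.mem_powerset.mpr (Finset.union_subset_union hp.1 hp.2)
  · intro S _
    simp
  · rintro ⟨S, T⟩ hp
    simp only [Finset.mem_product, Finset.mem_powerset] at hp
    have h1 := hp.1
    have h2 := hp.2
    refine Prod.ext ?_ ?_ <;> ext x <;> simp only [Finset.mem_inter, Finset.mem_union] <;> grind
  · intro S hS
    rw [Finset.mem_powerset] at hS
    rw [← Finset.inter_union_distrib_left]
    exact Finset.inter_eq_left.mpr hS
  · rintro ⟨S, T⟩ hp
    simp only [Finset.mem_product, Finset.mem_powerset] at hp
    have hST : _root_.Disjoint S T := hVW.mono hp.1 hp.2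
    have hm : signOn (S ∪ T) g = signOn S g * signOn T g := by
      by_cases h : (∀ x, g x ∈ S ↔ x ∈ S) ∧ ∀ x, g x ∈ T ↔ x ∈ T
      · exact signOn_union hST h.1 h.2
      · rw [signOn_of_not (T := S ∪ T)]
        · rw [not_and_or] at h
          rcases h with h | h <;> simp [signOn_of_not h]
        · intro h'
          have hmem : ∀ x, x ∈ S ∪ T → (x ∈ S ↔ x ∈ V) ∧ (x ∈ T ↔ x ∈ W) := fun x hx => by
            have h1 := @hp.1 x
            have h2 := @hp.2 x
            have h3 := hd x
            rw [Finset.mem_union] at hx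
            tauto
          have hSV : ∀ x, x ∈ S ↔ x ∈ S ∪ T ∧ x ∈ V := fun x =>
            ⟨fun hx => ⟨Finset.mem_union_left _ hx, hp.1 hx⟩, fun hx => ((hmem x hx.1).1).2 hx.2⟩
          have hTW : ∀ x, x ∈ T ↔ x ∈ S ∪ T ∧ x ∈ W := fun x =>
            ⟨fun hx => ⟨Finset.mem_union_right _ hx, hp.2 hx⟩, fun hx => ((hmem x hx.1).2).2 hx.2⟩
          exact h ⟨fun x => by rw [hSV, h', hV, ← hSV], fun x => by rw [hTW, h', hW, ← hTW]⟩
    rw [hm, Finset.card_union_of_disjoint hST, pow_add]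
    push_cast
    ring

lemma signGenFun_biUnion {ι : Type*} [DecidableEq ι] {g : Perm α} (s : Finset ι)
    (V : ι → Finset α) (hd : (s : Set ι).PairwiseDisjoint V)
    (hV : ∀ i ∈ s, ∀ x, g x ∈ V i ↔ x ∈ V i) :
    signGenFun g (s.biUnion V) = ∏ i ∈ s, signGenFun g (V i) := by
  induction s using Finset.induction_on with
  | empty => simp [signGenFun_empty]
  | insert i s hi ih =>
    rw [Finset.coe_insert, Set.pairwiseDisjoint_insert_of_notMem (by simpa using hi)] at hd
    rw [Finset.prod_insert hi, Finset.biUnion_insert, signGenFun_union,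
      ih hd.1 fun j hj => hV j (Finset.mem_insert_of_mem hj)]
    · rw [Finset.disjoint_biUnion_right]
      exact hd.2
    · exact hV i (Finset.mem_insert_self i s)
    · intro x
      simp only [Finset.mem_biUnion]
      exact exists_congr fun j => and_congr_right fun hj => hV j (Finset.mem_insert_of_mem hj) x

lemma signGenFun_singleton {g : Perm α} {x : α} (h : g x = x) :
    signGenFun g {x} = 1 - PowerSeries.X := by
  have hpow : ({x} : Finset α).powerset = {∅, {x}} := by
    ext S
    simp [Finset.subset_singleton_iff]
  rw [signGenFun, hpow, Finset.sum_pair (by simp),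
    signOn_eq_one (by simp), signOn_eq_one (by simpa using h)]
  simp [sub_eq_add_neg]

lemma signGenFun_support_of_mem_cycleFactorsFinset {g c : Perm α}
    (hc : c ∈ g.cycleFactorsFinset) :
    signGenFun g c.support = 1 - PowerSeries.X ^ #c.support := by
  have hcyc := Perm.mem_cycleFactorsFinset_iff.mp hc
  have hpres : ∀ x, g x ∈ c.support ↔ x ∈ c.support := fun x =>
    Perm.mem_cycleFactorsFinset_support hc x
  have hne : (∅ : Finset α) ≠ c.support := by
    intro h
    exact hcyc.1.ne_one (Perm.support_eq_empty_iff.mp h.symm)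
  have hzero : ∀ S ∈ c.support.powerset, S ∉ ({∅, c.support} : Finset (Finset α)) →
      (signOn S g : PowerSeries ℤ) * (-PowerSeries.X) ^ #S = 0 := by
    intro S hS hS'
    rw [Finset.mem_powerset] at hS
    simp only [Finset.mem_insert, Finset.mem_singleton, not_or] at hS'
    rw [signOn_of_not, Int.cast_zero, zero_mul]
    intro h
    obtain ⟨x, hx⟩ := Finset.nonempty_iff_ne_empty.mpr hS'.1
    refine hS'.2 (hS.antisymm fun y hy => ?_)
    obtain ⟨k, rfl⟩ := (Perm.isCycleOn_support_of_mem_cycleFactorsFinset hc).2 (hS hx) hy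
    have hp : ∀ k : ℕ, ∀ y, (g ^ k) y ∈ S ↔ y ∈ S := by
      intro k
      induction k with
      | zero => simp
      | succ k ih => intro y; rw [pow_succ', Perm.mul_apply, h, ih]
    rcases k with k | k
    · rw [Int.ofNat_eq_natCast, zpow_natCast]
      exact (hp k x).2 hx
    · rw [zpow_negSucc, ← hp (k + 1)]
      simpa using hx
  rw [signGenFun, ← Finset.sum_subset _ hzero, Finset.sum_pair hne, signOn_eq_one (by simp),
    signOn_eq_sign (w := c) hpres hcyc.2 (fun x hx => Perm.notMem_support.mp hx), hcyc.1.sign]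
  · simp only [Units.val_neg, Units.val_pow_eq_pow_val, Units.val_one]
    push_cast
    rw [neg_mul, ← mul_pow]
    simp [sub_eq_add_neg]
  · simp [Finset.insert_subset_iff]

lemma signGenFun_univ (g : Perm α) :
    signGenFun g univ =
      (g.partition.parts.map fun k => (1 - PowerSeries.X ^ k : PowerSeries ℤ)).prod := by
  have hs : g.support = g.cycleFactorsFinset.biUnion Perm.support := by
    ext x
    rw [Perm.mem_support_iff_mem_support_of_mem_cycleFactorsFinset, Finset.mem_biUnion]
  have h1 : signGenFun g g.support =
      ∏ c ∈ g.cycleFactorsFinset, (1 - PowerSeries.X ^ #c.support) := by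
    rw [hs, signGenFun_biUnion]
    · exact Finset.prod_congr rfl fun c hc => signGenFun_support_of_mem_cycleFactorsFinset hc
    · intro c hc d hd hcd
      exact (g.cycleFactorsFinset_pairwise_disjoint hc hd hcd).disjoint_support
    · exact fun c hc x => Perm.mem_cycleFactorsFinset_support hc x
  have h2 : signGenFun g g.supportᶜ = (1 - PowerSeries.X) ^ #g.supportᶜ := by
    have hfix : ∀ x ∈ g.supportᶜ, g x = x := fun x hx => by simpa using hx
    conv_lhs => rw [← Finset.biUnion_singleton_eq_self (s := g.supportᶜ)]
    rw [signGenFun_biUnion,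
      Finset.prod_congr rfl fun x hx => signGenFun_singleton (hfix x hx), Finset.prod_const]
    · intro x _ y _ hxy
      simpa using hxy
    · intro x hx y
      rw [Finset.mem_singleton, Finset.mem_singleton]
      conv_lhs => rw [← hfix x hx]
      exact g.injective.eq_iff
  rw [← Finset.union_compl g.support, signGenFun_union disjoint_compl_right, h1, h2,
    Perm.parts_partition, Multiset.map_add, Multiset.prod_add, Multiset.map_replicate,
    Multiset.prod_replicate, Finset.card_compl, Perm.cycleType_def, Multiset.map_map, pow_one]
  · rfl
  · simp
  · simp

lemma neg_one_pow_mul_sum_signOn (g : Perm α) (r : ℕ) :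
    (-1) ^ r * ∑ S ∈ powersetCard r (univ : Finset α), signOn S g =
      PowerSeries.coeff r
        (g.partition.parts.map fun k => (1 - PowerSeries.X ^ k : PowerSeries ℤ)).prod := by
  have hcoeff : ∀ S : Finset α, PowerSeries.coeff r
      ((signOn S g : PowerSeries ℤ) * (-PowerSeries.X) ^ #S) =
      if #S = r then (-1) ^ r * signOn S g else 0 := by
    intro S
    have h : (signOn S g : PowerSeries ℤ) * (-PowerSeries.X) ^ #S =
        PowerSeries.C (signOn S g * (-1) ^ #S) * PowerSeries.X ^ #S := by
      rw [neg_pow, map_mul, map_pow, map_neg, map_one, ← mul_assoc]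
      simp
    rw [h, PowerSeries.coeff_C_mul, PowerSeries.coeff_X_pow]
    split_ifs with h1 h2 h2
    · rw [h1]; ring
    · exact absurd h1.symm h2
    · exact absurd h2.symm h1
    · simp
  rw [← signGenFun_univ, signGenFun, map_sum, Finset.sum_congr rfl fun S _ => hcoeff S,
    ← Finset.sum_filter, Finset.powersetCard_eq_filter, Finset.mul_sum]

end CycleGenFun

section HookCoeff

/-- The signed value of the hook character with leg length `r` on the class with cycle lengths
`s`, as a coefficient of `∏ (1 - X ^ k) / (1 - X)`. -/
noncomputable def hookCoeff (r : ℕ) (s : Multiset ℕ) : ℤ :=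
  PowerSeries.coeff r
    ((s.map fun k => (1 - PowerSeries.X ^ k : PowerSeries ℤ)).prod * PowerSeries.mk fun _ => 1)

lemma hookCoeff_zero (s : Multiset ℕ) : hookCoeff 0 s =
    PowerSeries.coeff 0 (s.map fun k => (1 - PowerSeries.X ^ k : PowerSeries ℤ)).prod := by
  simp [hookCoeff]

lemma hookCoeff_succ (r : ℕ) (s : Multiset ℕ) : hookCoeff (r + 1) s = hookCoeff r s +
    PowerSeries.coeff (r + 1) (s.map fun k => (1 - PowerSeries.X ^ k : PowerSeries ℤ)).prod := by
  set P := (s.map fun k => (1 - PowerSeries.X ^ k : PowerSeries ℤ)).prod with hP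
  set M : PowerSeries ℤ := PowerSeries.mk fun _ => 1 with hM
  have h : P * M = P + P * M * PowerSeries.X := by
    have h1 : M * (1 - PowerSeries.X) = 1 := PowerSeries.mk_one_mul_one_sub_eq_one ℤ
    linear_combination P * h1
  rw [hookCoeff, hookCoeff, ← hP, ← hM]
  conv_lhs => rw [h]
  rw [map_add, PowerSeries.coeff_succ_mul_X, add_comm]

lemma sum_hookCoeff {n : ℕ} (hn : 0 < n) (m : n.Partition) :
    ∑ r ∈ range n, hookCoeff r m.parts = if m.parts = {n} then (n : ℤ) else 0 := by
  obtain ⟨k, hk⟩ : ∃ k, k ∈ m.parts := Multiset.exists_mem_of_ne_zero fun h => by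
    have := m.parts_sum
    simp [h] at this
    omega
  obtain ⟨s, hs⟩ := Multiset.exists_cons_of_mem hk
  have hkpos := m.parts_pos hk
  have hsum : k + s.sum = n := by
    rw [← Multiset.sum_cons, ← hs, m.parts_sum]
  set R : Polynomial ℤ := (s.map fun j => (1 - Polynomial.X ^ j : Polynomial ℤ)).prod with hR
  set Q : Polynomial ℤ := (∑ i ∈ range k, Polynomial.X ^ i) * R with hQ
  have hQc : ∀ r, hookCoeff r m.parts = Q.coeff r := by
    intro r
    have h1 : (m.parts.map fun k => (1 - PowerSeries.X ^ k : PowerSeries ℤ)).prod =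
        (1 - PowerSeries.X) * (Q : PowerSeries ℤ) := by
      have h2 : (1 - Polynomial.X ^ k : Polynomial ℤ) =
          (1 - Polynomial.X) * ∑ i ∈ range k, Polynomial.X ^ i := (mul_neg_geom_sum _ _).symm
      have h3 : (m.parts.map fun k => (1 - PowerSeries.X ^ k : PowerSeries ℤ)).prod =
          Polynomial.coeToPowerSeries.ringHom
            (m.parts.map fun k => (1 - Polynomial.X ^ k : Polynomial ℤ)).prod := by
        rw [map_multiset_prod, Multiset.map_map]
        congr 1
        refine Multiset.map_congr rfl fun k _ => ?_
        simp
      rw [h3, hs, Multiset.map_cons, Multiset.prod_cons, h2, mul_assoc, ← hR, ← hQ, map_mul]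
      simp
    have h4 : (PowerSeries.mk fun _ => 1 : PowerSeries ℤ) * (1 - PowerSeries.X) = 1 :=
      PowerSeries.mk_one_mul_one_sub_eq_one ℤ
    rw [hookCoeff, h1, mul_right_comm, mul_comm (1 - PowerSeries.X), h4, one_mul,
      Polynomial.coeff_coe]
  have hdeg : Q.natDegree < n := by
    have h1 : (∑ i ∈ range k, Polynomial.X ^ i : Polynomial ℤ).natDegree ≤ k - 1 := by
      refine Polynomial.natDegree_sum_le_of_forall_le _ _ fun i hi => ?_
      rw [Polynomial.natDegree_X_pow]
      have := Finset.mem_range.mp hi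
      omega
    have h2 : R.natDegree ≤ s.sum := by
      refine (Polynomial.natDegree_multiset_prod_le _).trans ?_
      rw [Multiset.map_map]
      conv_rhs => rw [← Multiset.map_id' s]
      refine Multiset.sum_map_le_sum_map _ _ fun j _ => ?_
      refine (Polynomial.natDegree_sub_le _ _).trans ?_
      simp
    have := Polynomial.natDegree_mul_le (p := ∑ i ∈ range k, Polynomial.X ^ i) (q := R)
    rw [← hQ] at this
    omega
  have heval : ∑ r ∈ range n, hookCoeff r m.parts = Q.eval 1 := by
    rw [Polynomial.eval_eq_sum_range' hdeg]
    simp [hQc]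
  have hR1 : R.eval 1 = if s = 0 then 1 else 0 := by
    split_ifs with h
    · simp [hR, h]
    · obtain ⟨j, hj⟩ := Multiset.exists_mem_of_ne_zero h
      obtain ⟨t, ht⟩ := Multiset.exists_cons_of_mem hj
      simp [hR, ht]
  rw [heval, hQ, Polynomial.eval_mul, hR1]
  by_cases h : s = 0
  · have hkn : k = n := by simpa [h] using hsum
    simp [h, hs, hkn, Polynomial.eval_finsetSum]
  · have h' : m.parts ≠ {n} := by
      intro h1
      rw [hs, ← Multiset.cons_zero, Multiset.cons_eq_cons] at h1
      rcases h1 with h1 | ⟨_, t, h2, h3⟩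
      · exact h h1.2
      · exact absurd h3.symm (Multiset.cons_ne_zero)
    simp [h, h']

/-- The conjugation average of the Young symmetrizer attached to the initial segment of length `r`
is a multiple of the hook character. -/
lemma choose_mul_conjSum_hookSymmetrizer {n : ℕ} (r : ℕ) (h : r < n) (g : Perm (Fin n)) :
    ((n - 1).choose r : ℤ) *
        conjSum (hookSymmetrizer (univ.filter fun i : Fin n => (i : ℕ) < r) ⟨r, h⟩) g =
      n.factorial * ((-1) ^ r * hookCoeff r g.partition.parts) := by
  induction r with
  | zero =>
    have h1 : ∀ k : Perm (Fin n), signOn ∅ k = 1 := fun k => signOn_eq_one (by simp)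
    have h0 := neg_one_pow_mul_sum_signOn g 0
    simp only [pow_zero, one_mul, Finset.powersetCard_zero, Finset.sum_singleton, h1] at h0
    rw [hookCoeff_zero, ← h0]
    simp [conjSum, hookSymmetrizer, h1, Fintype.card_perm]
  | succ r ih =>
    have ih := ih (by omega)
    set T : Finset (Fin n) := univ.filter fun i : Fin n => (i : ℕ) < r + 1 with hT
    set b : Fin n := ⟨r, by omega⟩ with hb
    have hcard : #T = r + 1 := by
      rw [hT, Fin.card_filter_val_lt]
      omega
    have hTb : T.erase b = univ.filter fun i : Fin n => (i : ℕ) < r := by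
      ext i
      simp only [hT, hb, Finset.mem_erase, Finset.mem_filter, Finset.mem_univ, true_and, ne_eq,
        Fin.ext_iff]
      omega
    have h1 := conjSum_hookSymmetrizer_add (T := T) (z := ⟨r + 1, h⟩) (b := b)
      (by simp [hT]) (by simp [hT, hb]) g
    have h2 := choose_mul_conjSum_signOn T g
    have h3 := neg_one_pow_mul_sum_signOn g (r + 1)
    rw [hTb] at h1
    rw [hcard, Fintype.card_fin] at h1 h2
    have hsucc := hookCoeff_succ r g.partition.parts
    rw [← h3] at hsucc
    obtain ⟨m, rfl⟩ : ∃ m, n = m + 1 := ⟨n - 1, by omega⟩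
    rw [Nat.add_sub_cancel] at ih ⊢
    have hc1 : ((m + 1).choose (r + 1) : ℤ) * (r + 1) = (m + 1) * m.choose r := by
      exact_mod_cast (Nat.add_one_mul_choose_eq m r).symm
    have hc2 : ((m + 1).choose (r + 1) : ℤ) * (m - r) = (m + 1) * m.choose (r + 1) := by
      have h5 : ((m + 1).choose (r + 1) : ℤ) = m.choose r + m.choose (r + 1) := by
        exact_mod_cast Nat.choose_succ_succ m r
      have h6 : (m.choose (r + 1) : ℤ) * (r + 1) = m.choose r * (m - r) := by
        have := Nat.choose_succ_right_eq m r
        rw [← Nat.cast_sub (by omega : r ≤ m)]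
        exact_mod_cast this
      rw [h5]
      linear_combination -h6
    have hne : ((m : ℤ) + 1) ≠ 0 := by positivity
    refine mul_left_cancel₀ hne ?_
    push_cast at h1 h2 ⊢
    have hsq : ((-1 : ℤ) ^ r) * (-1) ^ r = 1 := by
      rw [← mul_pow]; simp
    rw [hsucc]
    set A := conjSum (hookSymmetrizer T ⟨r + 1, h⟩) g
    set B := conjSum (hookSymmetrizer (univ.filter fun i : Fin (m + 1) => (i : ℕ) < r) b) g
    set D := conjSum (signOn T) g
    set E := ∑ S ∈ powersetCard (r + 1) (univ : Finset (Fin (m + 1))), signOn S g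
    rw [pow_succ]
    linear_combination (m + 1).choose (r + 1) * h1 - hc2 * A - hc1 * B - (m + 1) * ih
      + (m + 1) * h2 - (m + 1) * (m + 1).factorial * E * hsq

end HookCoeff

section CycleTypeClass

variable {n : ℕ}

lemma Nat.Partition.parts_eq_filter_add_replicate (m : n.Partition) :
    m.parts = m.parts.filter (2 ≤ ·) +
      Multiset.replicate (n - (m.parts.filter (2 ≤ ·)).sum) 1 := by
  have h1 : m.parts.filter (fun i => ¬ 2 ≤ i) =
      Multiset.replicate (m.parts.filter fun i => ¬ 2 ≤ i).card 1 := by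
    refine Multiset.eq_replicate_card.mpr fun i hi => ?_
    rw [Multiset.mem_filter] at hi
    have := m.parts_pos hi.1
    omega
  have h2 := Multiset.filter_add_not (2 ≤ ·) m.parts
  have h3 : (m.parts.filter (2 ≤ ·)).sum + (m.parts.filter fun i => ¬ 2 ≤ i).card = n := by
    have h4 := congrArg Multiset.sum h2
    rw [Multiset.sum_add, m.parts_sum, h1, Multiset.sum_replicate, smul_eq_mul, mul_one] at h4
    exact h4
  conv_lhs => rw [← h2, h1]
  congr 2
  omega

lemma hasCycleType_iff_cycleType_eq {σ : Perm (Fin n)} {m : n.Partition} :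
    hasCycleType σ m ↔ σ.cycleType = m.parts.filter (2 ≤ ·) := by
  rw [hasCycleType]
  constructor
  · intro h
    rw [← h, Perm.filter_parts_partition_eq_cycleType]
  · intro h
    rw [Perm.parts_partition, ← Perm.sum_cycleType, h, Fintype.card_fin]
    exact m.parts_eq_filter_add_replicate.symm

lemma hasCycleType_conj {σ : Perm (Fin n)} {m : n.Partition} (x : Perm (Fin n)) :
    hasCycleType (x⁻¹ * σ * x) m ↔ hasCycleType σ m := by
  have h : Perm.cycleType (x⁻¹ * σ * x) = σ.cycleType := by
    simpa using Perm.cycleType_conj (σ := σ) (τ := x⁻¹)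
  rw [hasCycleType_iff_cycleType_eq, hasCycleType_iff_cycleType_eq, h]

lemma zPart_eq (hn : 0 < n) (m : n.Partition) :
    zPart m = (n - (m.parts.filter (2 ≤ ·)).sum).factorial * (m.parts.filter (2 ≤ ·)).prod *
      ∏ i ∈ (m.parts.filter (2 ≤ ·)).toFinset,
        ((m.parts.filter (2 ≤ ·)).count i).factorial := by
  have hmem : ∀ i ∈ m.parts, i ∈ range (n + 1) := fun i hi => by
    have := Multiset.le_sum_of_mem hi
    rw [m.parts_sum] at this
    exact Finset.mem_range.mpr (by omega)
  have hparts := m.parts_eq_filter_add_replicate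
  set f := m.parts.filter (2 ≤ ·) with hf
  have hprod : ∏ i ∈ range (n + 1), i ^ m.parts.count i = f.prod := by
    rw [← Finset.prod_multiset_count_of_subset m.parts (range (n + 1))
      (fun i hi => hmem i (Multiset.mem_toFinset.mp hi)), hparts]
    simp
  have hone : m.parts.count 1 = n - f.sum := by
    have : f.count 1 = 0 := by simp [hf]
    rw [hparts]
    simp [this]
  have hfact : ∏ i ∈ (range (n + 1)).erase 1, (m.parts.count i).factorial =
      ∏ i ∈ f.toFinset, (f.count i).factorial := by
    have hcount : ∀ i ≠ 1, m.parts.count i = f.count i := fun i hi => by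
      rw [hparts, Multiset.count_add, Multiset.count_replicate, if_neg hi.symm, add_zero]
    rw [Finset.prod_congr rfl fun i hi => by rw [hcount i (Finset.ne_of_mem_erase hi)]]
    symm
    refine Finset.prod_subset (fun i hi => ?_) fun i _ hi => ?_
    · rw [Multiset.mem_toFinset, hf, Multiset.mem_filter] at hi
      exact Finset.mem_erase.mpr ⟨by omega, hmem i hi.1⟩
    · rw [Multiset.count_eq_zero_of_notMem (fun h => hi (Multiset.mem_toFinset.mpr h)),
        Nat.factorial_zero]
  rw [zPart, Finset.prod_mul_distrib, hprod,
    ← Finset.mul_prod_erase (range (n + 1)) _ (Finset.mem_range.mpr (by omega : 1 < n + 1)), hone,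
    hfact]
  ring

open Classical in
/-- The conjugacy class of permutations of cycle type `m`. -/
noncomputable def cycleTypeClass (m : n.Partition) : Finset (Perm (Fin n)) :=
  univ.filter fun g => hasCycleType g m

lemma mem_cycleTypeClass {m : n.Partition} {g : Perm (Fin n)} :
    g ∈ cycleTypeClass m ↔ hasCycleType g m := by
  simp [cycleTypeClass]

lemma card_cycleTypeClass_mul_zPart (hn : 0 < n) (m : n.Partition) :
    #(cycleTypeClass m) * zPart m = n.factorial := by
  have h := Perm.card_of_cycleType_mul_eq (Fin n) (m.parts.filter (2 ≤ ·))
  rw [if_pos, Fintype.card_fin, ← zPart_eq hn] at h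
  · rw [← h]
    congr 2
    ext g
    rw [mem_cycleTypeClass, hasCycleType_iff_cycleType_eq]
    simp
  · refine ⟨?_, fun a ha => (Multiset.mem_filter.mp ha).2⟩
    rw [Fintype.card_fin]
    conv_rhs => rw [← m.parts_sum]
    conv_rhs => rw [← Multiset.filter_add_not (2 ≤ ·) m.parts, Multiset.sum_add]
    exact Nat.le_add_right _ _

lemma numFactorizations_eq_card (lam mu : n.Partition) (σ : Perm (Fin n)) :
    numFactorizations n lam mu σ =
      #{p ∈ cycleTypeClass lam ×ˢ cycleTypeClass mu | p.1 * p.2 = σ} := by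
  classical
  rw [numFactorizations, Nat.card_eq_fintype_card, Fintype.card_subtype]
  congr 1
  ext p
  simp [mem_cycleTypeClass, and_assoc]

lemma numFactorizations_eq_of_hasCycleType {lam mu nu : n.Partition} {σ τ : Perm (Fin n)}
    (hσ : hasCycleType σ nu) (hτ : hasCycleType τ nu) :
    numFactorizations n lam mu σ = numFactorizations n lam mu τ := by
  have hconj : IsConj σ τ := by
    rw [Perm.isConj_iff_cycleType_eq, hasCycleType_iff_cycleType_eq.mp hσ,
      hasCycleType_iff_cycleType_eq.mp hτ]
  obtain ⟨x, rfl⟩ := isConj_iff.mp hconj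
  have hinv : ∀ {g : Perm (Fin n)} {m : n.Partition}, hasCycleType g m →
      hasCycleType (x * g * x⁻¹) m := fun {g m} h => by
    simpa using (hasCycleType_conj x⁻¹).mpr h
  rw [numFactorizations_eq_card, numFactorizations_eq_card]
  refine Finset.card_bij' (fun p _ => (x * p.1 * x⁻¹, x * p.2 * x⁻¹))
    (fun p _ => (x⁻¹ * p.1 * x, x⁻¹ * p.2 * x)) ?_ ?_ ?_ ?_
  · rintro ⟨a, b⟩ hp
    simp only [Finset.mem_filter, Finset.mem_product, mem_cycleTypeClass] at hp ⊢
    refine ⟨⟨hinv hp.1.1, hinv hp.1.2⟩, ?_⟩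
    rw [← hp.2]
    group
  · rintro ⟨a, b⟩ hp
    simp only [Finset.mem_filter, Finset.mem_product, mem_cycleTypeClass, hasCycleType_conj]
      at hp ⊢
    refine ⟨hp.1, ?_⟩
    have h : x⁻¹ * a * x * (x⁻¹ * b * x) = x⁻¹ * (a * b) * x := by group
    rw [h, hp.2]
    group
  · rintro ⟨a, b⟩ _
    ext1 <;> dsimp only <;> group
  · rintro ⟨a, b⟩ _
    ext1 <;> dsimp only <;> group

lemma card_cycleTypeClass_mul_numFactorizations (lam mu nu : n.Partition) {σ : Perm (Fin n)}
    (hσ : hasCycleType σ nu) :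
    #(cycleTypeClass nu) * numFactorizations n lam mu σ =
      #{p ∈ cycleTypeClass lam ×ˢ cycleTypeClass mu | p.1 * p.2 ∈ cycleTypeClass nu} := by
  rw [← smul_eq_mul, ← Finset.sum_const, Finset.card_eq_sum_card_fiberwise
    (t := cycleTypeClass nu) (f := fun p : Perm (Fin n) × Perm (Fin n) => p.1 * p.2)
    (s := {p ∈ cycleTypeClass lam ×ˢ cycleTypeClass mu | p.1 * p.2 ∈ cycleTypeClass nu})
    (fun p hp => (Finset.mem_filter.mp hp).2)]
  refine Finset.sum_congr rfl fun τ hτ => ?_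
  rw [numFactorizations_eq_of_hasCycleType hσ (mem_cycleTypeClass.mp hτ),
    numFactorizations_eq_card, Finset.filter_filter]
  congr 1
  refine Finset.filter_congr fun p _ => ?_
  constructor
  · exact fun h => ⟨h ▸ hτ, h⟩
  · exact fun h => h.2

/-- The central character of a hook shape is multiplicative on products of class sums. -/
lemma choose_mul_sum_hookCoeff (r : ℕ) (h : r < n) (lam mu : n.Partition) :
    ((n - 1).choose r : ℤ) * ∑ p ∈ cycleTypeClass lam ×ˢ cycleTypeClass mu,
        (-1) ^ r * hookCoeff r (p.1 * p.2).partition.parts =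
      #(cycleTypeClass lam) * #(cycleTypeClass mu) *
        (charSn n (hookPartition n r h) lam * charSn n (hookPartition n r h) mu) := by
  set B : ℤ := ((n - 1).choose r : ℤ) with hB
  set A := conjSum (hookSymmetrizer (univ.filter fun i : Fin n => (i : ℕ) < r) ⟨r, h⟩) with hA
  have hBA : ∀ g, B * A g = n.factorial * ((-1) ^ r * hookCoeff r g.partition.parts) :=
    choose_mul_conjSum_hookSymmetrizer r h
  have hchar : ∀ {m : n.Partition}, ∀ g ∈ cycleTypeClass m,
      B * A g = n.factorial * charSn n (hookPartition n r h) m := fun {m} g hg => by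
    rw [hBA, mem_cycleTypeClass.mp hg, charSn_hookPartition, hookCoeff]
  have hmul : ∀ g ∈ cycleTypeClass mu, (n.factorial : ℤ) * (B * ∑ a ∈ cycleTypeClass lam,
      (-1) ^ r * hookCoeff r (a * g).partition.parts) = n.factorial *
      (#(cycleTypeClass lam) * (charSn n (hookPartition n r h) lam *
        charSn n (hookPartition n r h) mu)) := fun g hg => by
    have h1 := sum_conjSum_hookSymmetrizer_mul
      (T := univ.filter fun i : Fin n => (i : ℕ) < r) (z := ⟨r, h⟩) (by simp)
      (C := cycleTypeClass lam)
      (fun a ha x => mem_cycleTypeClass.mpr ((hasCycleType_conj x).mpr (mem_cycleTypeClass.mp ha)))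
      g
    rw [← hA, Fintype.card_fin] at h1
    have h2 : B * ∑ a ∈ cycleTypeClass lam, A a = #(cycleTypeClass lam) *
        (n.factorial * charSn n (hookPartition n r h) lam) := by
      rw [Finset.mul_sum, Finset.sum_congr rfl hchar, Finset.sum_const, nsmul_eq_mul]
    have h3 : (n.factorial : ℤ) * ∑ a ∈ cycleTypeClass lam,
        (-1) ^ r * hookCoeff r (a * g).partition.parts =
          B * ∑ a ∈ cycleTypeClass lam, A (a * g) := by
      rw [Finset.mul_sum, Finset.mul_sum]
      exact Finset.sum_congr rfl fun a _ => (hBA _).symm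
    have hne : (n.factorial : ℤ) ≠ 0 := by exact_mod_cast n.factorial_ne_zero
    refine mul_left_cancel₀ hne ?_
    have h4 := hchar g hg
    set S1 := ∑ a ∈ cycleTypeClass lam, A (a * g)
    set S2 := ∑ a ∈ cycleTypeClass lam, A a
    linear_combination n.factorial * B * h3 + B ^ 2 * h1 + B * A g * h2 +
      #(cycleTypeClass lam) * (n.factorial * charSn n (hookPartition n r h) lam) * h4
  have hne : (n.factorial : ℤ) ≠ 0 := by exact_mod_cast n.factorial_ne_zero
  rw [Finset.sum_product_right, Finset.mul_sum,
    Finset.sum_congr rfl fun g hg => mul_left_cancel₀ hne (hmul g hg), Finset.sum_const,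
    nsmul_eq_mul]
  ring

end CycleTypeClass

/-- Goupil–Schaeffer's formula (4): the number of factorizations of an
n-cycle into permutations of types λ and μ. -/
theorem numFactorizations_cycle_eq_hook_sum (n : ℕ) (hn : 0 < n)
    (lam mu : n.Partition) (σ : Equiv.Perm (Fin n))
    (hσ : hasCycleType σ (Nat.Partition.indiscrete n)) :
    (numFactorizations n lam mu σ : ℚ) =
      (n : ℚ) / ((zPart lam : ℚ) * (zPart mu : ℚ)) *
        ∑ r ∈ (Finset.range n).attach,
          (-1 : ℚ) ^ (r : ℕ) * ((r : ℕ).factorial : ℚ) * ((n - 1 - (r : ℕ)).factorial : ℚ) *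
            (charSn n (hookPartition n r (Finset.mem_range.mp r.2)) lam : ℚ) *
            (charSn n (hookPartition n r (Finset.mem_range.mp r.2)) mu : ℚ) := by
  have hcyc : ∀ g : Perm (Fin n), ∑ r ∈ (range n).attach,
      (-1 : ℤ) ^ (r : ℕ) * ((-1) ^ (r : ℕ) * hookCoeff r g.partition.parts) =
      if g ∈ cycleTypeClass (Nat.Partition.indiscrete n) then (n : ℤ) else 0 := fun g => by
    have h1 := sum_attach (range n) fun r =>
      (-1 : ℤ) ^ r * ((-1) ^ r * hookCoeff r g.partition.parts)
    rw [h1]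
    have h2 := sum_hookCoeff (by rwa [Fintype.card_fin]) g.partition
    simp only [Fintype.card_fin] at h2
    simp only [mem_cycleTypeClass, hasCycleType, Nat.Partition.indiscrete_parts hn.ne']
    rw [← h2]
    refine Finset.sum_congr rfl fun r _ => ?_
    rw [← mul_assoc, ← mul_pow]
    simp
  have hcount : (n : ℤ) * (#(cycleTypeClass (Nat.Partition.indiscrete n)) *
      numFactorizations n lam mu σ) = ∑ r ∈ (range n).attach, (-1) ^ (r : ℕ) *
        ∑ p ∈ cycleTypeClass lam ×ˢ cycleTypeClass mu,
          (-1) ^ (r : ℕ) * hookCoeff r (p.1 * p.2).partition.parts := by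
    have h1 := card_cycleTypeClass_mul_numFactorizations lam mu _ hσ
    rw [← Nat.cast_mul, h1]
    simp only [Finset.mul_sum]
    rw [Finset.sum_comm, Finset.sum_congr rfl fun p _ => hcyc (p.1 * p.2), ← Finset.sum_filter,
      Finset.sum_const, nsmul_eq_mul, mul_comm]
  have hzn : #(cycleTypeClass (Nat.Partition.indiscrete n)) * n = n.factorial := by
    have h1 := card_cycleTypeClass_mul_zPart hn (Nat.Partition.indiscrete n)
    have h2 : zPart (Nat.Partition.indiscrete n) = n := by
      rw [zPart, Nat.Partition.indiscrete_parts hn.ne',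
        Finset.prod_eq_single n (fun i _ hi => by simp [hi])
          (fun h => absurd (Finset.mem_range.mpr n.lt_succ_self) h)]
      simp
    rwa [h2] at h1
  have hzl := card_cycleTypeClass_mul_zPart hn lam
  have hzm := card_cycleTypeClass_mul_zPart hn mu
  set L := #(cycleTypeClass lam)
  set M := #(cycleTypeClass mu)
  set K := #(cycleTypeClass (Nat.Partition.indiscrete n))
  set c := numFactorizations n lam mu σ
  set E := ∑ r ∈ (range n).attach,
    (-1 : ℚ) ^ (r : ℕ) * ((r : ℕ).factorial : ℚ) * ((n - 1 - (r : ℕ)).factorial : ℚ) *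
      (charSn n (hookPartition n r (Finset.mem_range.mp r.2)) lam : ℚ) *
      (charSn n (hookPartition n r (Finset.mem_range.mp r.2)) mu : ℚ) with hE
  have hsum : (L : ℚ) * M * E = (n - 1).factorial * (n * (K * c)) := by
    have h1 := congrArg (Int.cast : ℤ → ℚ) hcount
    rw [Int.cast_sum] at h1
    push_cast at h1
    rw [h1, hE, Finset.mul_sum, Finset.mul_sum]
    refine Finset.sum_congr rfl fun r _ => ?_
    have hr := Finset.mem_range.mp r.2
    have h2 := congrArg (Int.cast : ℤ → ℚ) (choose_mul_sum_hookCoeff r hr lam mu)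
    push_cast at h2
    have h3 : ((n - 1).choose r : ℚ) * (r : ℕ).factorial * (n - 1 - r).factorial =
        (n - 1).factorial := by
      exact_mod_cast Nat.choose_mul_factorial_mul_factorial (by omega : (r : ℕ) ≤ n - 1)
    rw [← h3]
    linear_combination -(-1 : ℚ) ^ (r : ℕ) * (r : ℕ).factorial * (n - 1 - r).factorial * h2
  have hfac : (n : ℚ) * (n - 1).factorial = n.factorial := by
    exact_mod_cast Nat.mul_factorial_pred hn.ne'
  have hne : (n.factorial : ℚ) ≠ 0 := by exact_mod_cast n.factorial_ne_zero
  have hL : (L : ℚ) * zPart lam = n.factorial := by exact_mod_cast hzl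
  have hM : (M : ℚ) * zPart mu = n.factorial := by exact_mod_cast hzm
  have hK : (K : ℚ) * n = n.factorial := by exact_mod_cast hzn
  have hL0 := hL ▸ hne
  have hM0 := hM ▸ hne
  have hzl0 := right_ne_zero_of_mul hL0
  have hzm0 := right_ne_zero_of_mul hM0
  rw [div_mul_eq_mul_div, eq_div_iff (mul_ne_zero hzl0 hzm0)]
  refine mul_left_cancel₀ (mul_ne_zero (left_ne_zero_of_mul hL0) (left_ne_zero_of_mul hM0)) ?_
  linear_combination c * M * zPart mu * hL + c * n.factorial * hM - n * hsum
    - c * n.factorial * hfac - c * n * (n - 1).factorial * hK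
end

section
/- For partitions λ, μ of n, the number of factorizations of a fixed n-cycle as a product of a permutation of type λ and a permutation of type μ equals n · 2^{-n-1} · Σ_{k,l} r_λ^{kl} · r_μ^{lk} · k! · l!, where r_λ^{kl} is the coefficient of a^k b^l in R_λ(a,b) = (1/(z_λ b)) ∏_i Q_{λ_i}(a,b) with Q_m(a,b) = (a+b)^m − (a−b)^m. In particular c^n_{λμ} is a sum of nonnegative terms. -/
open Equiv Finset MvPolynomial

/-- The exponent vector of the monomial `a^k b^l` in two variables. -/
noncomputable def expVec (k l : ℕ) : Fin 2 →₀ ℕ :=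
  Finsupp.equivFunOnFinite.symm (fun j : Fin 2 => if j = 0 then k else l)

section Kernel

variable {V ι : Type*} [Fintype V] [DecidableEq V] [Fintype ι] [DecidableEq ι]

/-- The matrix of the permutation `g`, followed by the projection that kills constant vectors. -/
def centeredPermMatrix (g : Perm V) : Matrix V V ℚ :=
  Matrix.of fun x y => (if g x = y then 1 else 0) - (Fintype.card V : ℚ)⁻¹

/-- The weighted sum over all permutations of the minors of `centeredPermMatrix` with rows `s`
and columns `t`. -/
def minorSum (c : Perm V → ℚ) (s t : ι → V) : ℚ :=
  ∑ g, c g * ((centeredPermMatrix g).submatrix s t).det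

theorem centeredPermMatrix_mul_submatrix {κ : Type*} (g h : Perm V) (s t : κ → V) :
    (centeredPermMatrix (g * h)).submatrix s t = (centeredPermMatrix g).submatrix (h ∘ s) t := rfl

theorem centeredPermMatrix_conj_apply (g h : Perm V) (x y : V) :
    centeredPermMatrix (h * g * h⁻¹) (h x) (h y) = centeredPermMatrix g x y := by
  simp [centeredPermMatrix]

theorem sum_centeredPermMatrix_apply (g : Perm V) (y : V) :
    ∑ x, centeredPermMatrix g x y = 0 := by
  have : Nonempty V := ⟨y⟩
  have h : ∀ x, (g x = y) ↔ (x = g⁻¹ y) := fun x => Perm.eq_inv_iff_eq.symm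
  simp [centeredPermMatrix, Finset.sum_sub_distrib, h]

theorem minorSum_comp_perm (c : Perm V → ℚ) (s t : ι → V) (π : Perm ι) :
    minorSum c (s ∘ π) t = (Perm.sign π : ℤ) * minorSum c s t := by
  unfold minorSum
  rw [Finset.mul_sum]
  refine Finset.sum_congr rfl fun g _ => ?_
  have := Matrix.det_permute π ((centeredPermMatrix g).submatrix s t)
  rw [Matrix.submatrix_submatrix] at this
  simp only [Function.comp_id] at this
  rw [this]; ring

theorem minorSum_of_not_injective (c : Perm V → ℚ) {s : ι → V} (t : ι → V)
    (hs : ¬ Function.Injective s) : minorSum c s t = 0 := by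
  unfold minorSum
  obtain ⟨i, j, hij, hne⟩ : ∃ i j, s i = s j ∧ i ≠ j := by
    simpa [Function.Injective] using hs
  refine Finset.sum_eq_zero fun g _ => ?_
  rw [Matrix.det_zero_of_row_eq hne (by ext k; simp [hij]), mul_zero]

theorem minorSum_perm_comp {c : Perm V → ℚ} (hc : ∀ g h, c (h * g * h⁻¹) = c g) (h : Perm V)
    (s t : ι → V) : minorSum c (h ∘ s) (h ∘ t) = minorSum c s t := by
  unfold minorSum
  refine (Fintype.sum_equiv (MulAut.conj h).toEquiv _ _ fun g => ?_).symm
  simp only [MulEquiv.toEquiv_eq_coe, EquivLike.coe_coe, MulAut.conj_apply, hc]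
  congr 2
  ext k l
  simp [centeredPermMatrix_conj_apply]

theorem sum_minorSum_update (c : Perm V → ℚ) (s t : ι → V) (k : ι) :
    ∑ a, minorSum c (Function.update s k a) t = 0 := by
  unfold minorSum
  rw [Finset.sum_comm]
  refine Finset.sum_eq_zero fun g _ => ?_
  rw [← Finset.mul_sum]
  have h : ∀ a, (centeredPermMatrix g).submatrix (Function.update s k a) t =
      ((centeredPermMatrix g).submatrix s t).updateRow k
        (fun l => centeredPermMatrix g a (t l)) := by
    intro a
    ext i l
    by_cases hi : i = k
    · subst hi; simp
    · simp [hi]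
  have h2 : ∑ a, (((centeredPermMatrix g).submatrix s t).updateRow k
        (fun l => centeredPermMatrix g a (t l))).det = 0 := by
    have := (Matrix.detRowAlternating (R := ℚ) (n := ι)).toMultilinearMap.map_update_sum
      Finset.univ k (fun a l => centeredPermMatrix g a (t l))
      ((centeredPermMatrix g).submatrix s t)
    refine this.symm.trans ?_
    have h0 : (∑ a, fun l => centeredPermMatrix g a (t l)) = (0 : ι → ℚ) := by
      ext l; simp [sum_centeredPermMatrix_apply]
    rw [h0]
    exact MultilinearMap.map_update_zero _ _ _
  simp only [h, h2, mul_zero]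

theorem minorSum_eq_zero_of_forall_mem_range {c : Perm V → ℚ} {s t : ι → V}
    (h0 : minorSum c t t = 0) (hs : ∀ k, s k ∈ Set.range t) : minorSum c s t = 0 := by
  by_cases hinj : Function.Injective s
  · choose f hf using hs
    have hfinj : Function.Injective f := fun i j hij => hinj (by rw [← hf i, ← hf j, hij])
    have hbij := Finite.injective_iff_bijective.mp hfinj
    have : s = t ∘ (Equiv.ofBijective f hbij) := by
      ext k; simp [hf]
    rw [this, minorSum_comp_perm, h0, mul_zero]
  · exact minorSum_of_not_injective c t hinj

/-- A class function whose diagonal minor sums vanish has vanishing minor sums: on every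
exterior power of the standard representation, a central element is determined by its trace. -/
theorem minorSum_eq_zero {c : Perm V → ℚ} (hc : ∀ g h, c (h * g * h⁻¹) = c g) {t : ι → V}
    (h0 : minorSum c t t = 0) (s : ι → V) : minorSum c s t = 0 := by
  by_cases hinj : Function.Injective s
  swap
  · exact minorSum_of_not_injective c t hinj
  by_cases hall : ∀ k, s k ∈ Set.range t
  · exact minorSum_eq_zero_of_forall_mem_range h0 hall
  push Not at hall
  obtain ⟨k, hk⟩ := hall
  have hk' : ∀ i, t i ≠ s k := fun i hi => hk ⟨i, hi⟩
  by_cases hother : ∃ l, l ≠ k ∧ s l ∉ Set.range t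
  · obtain ⟨l, hlk, hl⟩ := hother
    have hl' : ∀ i, t i ≠ s l := fun i hi => hl ⟨i, hi⟩
    have h1 : (swap (s k) (s l)) ∘ t = t := by
      ext i; exact swap_apply_of_ne_of_ne (hk' i) (hl' i)
    have h2 : (swap (s k) (s l)) ∘ s = s ∘ swap k l := by
      ext i
      simp only [Function.comp_apply]
      exact (hinj.swap_apply k l i)
    have h3 := minorSum_perm_comp hc (swap (s k) (s l)) s t
    rw [h1, h2, minorSum_comp_perm, Perm.sign_swap hlk.symm] at h3
    push_cast at h3
    linarith
  · push Not at hother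
    have hsum := sum_minorSum_update c s t k
    have hterm : ∀ a, minorSum c (Function.update s k a) t =
        if a ∈ Set.range t then 0 else minorSum c s t := by
      intro a
      split_ifs with ha
      · refine minorSum_eq_zero_of_forall_mem_range h0 fun i => ?_
        by_cases hi : i = k
        · subst hi; simpa using ha
        · simpa [hi] using hother i hi
      · have ha' : ∀ i, t i ≠ a := fun i hi => ha ⟨i, hi⟩
        have h1 : (swap a (s k)) ∘ t = t := by
          ext i; exact swap_apply_of_ne_of_ne (ha' i) (hk' i)
        have h2 : (swap a (s k)) ∘ s = Function.update s k a := by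
          ext i
          by_cases hi : i = k
          · subst hi; simp
          · obtain ⟨j, hj⟩ := hother i hi
            simp only [Function.comp_apply, Function.update_of_ne hi]
            exact swap_apply_of_ne_of_ne (hj ▸ ha' j) (hj ▸ hk' j)
        rw [← h2]
        conv_lhs => rw [← h1]
        exact minorSum_perm_comp hc _ s t
    simp only [hterm] at hsum
    rw [Finset.sum_ite, Finset.sum_const_zero, zero_add, Finset.sum_const, nsmul_eq_mul] at hsum
    refine (mul_eq_zero.mp hsum).resolve_left ?_
    exact Nat.cast_ne_zero.mpr (Finset.card_ne_zero.mpr ⟨s k, by simpa using hk'⟩)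

theorem det_centeredPermMatrix_one_submatrix {t : ι → V} (ht : Function.Injective t) :
    ((centeredPermMatrix (1 : Perm V)).submatrix t t).det =
      1 - (Fintype.card ι : ℚ) / Fintype.card V := by
  have : (centeredPermMatrix (1 : Perm V)).submatrix t t =
      1 + Matrix.replicateCol Unit (fun _ : ι => -(Fintype.card V : ℚ)⁻¹) *
        Matrix.replicateRow Unit (fun _ : ι => (1 : ℚ)) := by
    ext i j
    simp [centeredPermMatrix, Matrix.mul_apply, Matrix.one_apply, ht.eq_iff, sub_eq_add_neg]
  rw [this, Matrix.det_one_add_replicateCol_mul_replicateRow]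
  simp [dotProduct, div_eq_mul_inv, sub_eq_add_neg]

theorem sum_sum_minor_mul {c d : Perm V → ℚ} (hc : ∀ g h, c (h * g * h⁻¹) = c g)
    {t : ι → V} (ht : Function.Injective t) :
    (1 - (Fintype.card ι : ℚ) / Fintype.card V) *
      ∑ g, ∑ h, c g * d h * ((centeredPermMatrix (g * h)).submatrix t t).det =
    minorSum c t t * minorSum d t t := by
  set u : ℚ := 1 - (Fintype.card ι : ℚ) / Fintype.card V with hu
  have hone : ∀ s : ι → V, minorSum (Pi.single 1 1) s t =
      ((centeredPermMatrix (1 : Perm V)).submatrix s t).det := by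
    intro s
    simp [minorSum, Pi.single_apply]
  have hlin : ∀ s : ι → V, minorSum (fun g => u * c g - minorSum c t t * (Pi.single 1 1 :
      Perm V → ℚ) g) s t = u * minorSum c s t - minorSum c t t *
        ((centeredPermMatrix (1 : Perm V)).submatrix s t).det := by
    intro s
    rw [← hone]
    simp only [minorSum, sub_mul, Finset.sum_sub_distrib, Finset.mul_sum, mul_assoc]
  have key : ∀ s : ι → V, u * minorSum c s t = minorSum c t t *
        ((centeredPermMatrix (1 : Perm V)).submatrix s t).det := by
    intro s
    have := minorSum_eq_zero (c := fun g => u * c g - minorSum c t t * (Pi.single 1 1 :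
      Perm V → ℚ) g) (t := t) ?_ ?_ s
    · rw [hlin] at this; linarith
    · intro g h
      have : h * g * h⁻¹ = 1 ↔ g = 1 := by
        rw [mul_inv_eq_one]; simp
      simp only [hc, Pi.single_apply, this]
    · rw [hlin, det_centeredPermMatrix_one_submatrix ht]; ring
  rw [Finset.sum_comm, Finset.mul_sum]
  have : ∀ h : Perm V, u * ∑ g, c g * d h * ((centeredPermMatrix (g * h)).submatrix t t).det =
      minorSum c t t * (d h * ((centeredPermMatrix h).submatrix t t).det) := by
    intro h
    have e : ∑ g, c g * d h * ((centeredPermMatrix (g * h)).submatrix t t).det =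
        d h * minorSum c (h ∘ t) t := by
      simp only [minorSum, Finset.mul_sum, centeredPermMatrix_mul_submatrix]
      exact Finset.sum_congr rfl fun g _ => by ring
    have e2 : ((centeredPermMatrix (1 : Perm V)).submatrix (h ∘ t) t) =
        (centeredPermMatrix h).submatrix t t := by
      rw [← centeredPermMatrix_mul_submatrix, one_mul]
    rw [e, mul_left_comm, key, e2]; ring
  simp only [this, minorSum, Finset.mul_sum]

end Kernel

section Charpoly

variable {V ι : Type*} [Fintype V] [DecidableEq V] [Fintype ι] [DecidableEq ι]

theorem permMatrix_apply {V : Type*} [DecidableEq V] (g : Perm V) (x y : V) :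
    g.permMatrix ℚ x y = if g x = y then 1 else 0 := by
  simp [Perm.permMatrix, PEquiv.toMatrix_apply, eq_comm]

theorem Equiv.Perm.Disjoint.permMatrix_add {g h : Perm V} (hd : g.Disjoint h) :
    g.permMatrix ℚ + h.permMatrix ℚ = 1 + g.permMatrix ℚ * h.permMatrix ℚ := by
  rw [← Matrix.permMatrix_mul]
  ext x y
  rw [Matrix.add_apply, Matrix.add_apply, permMatrix_apply, permMatrix_apply, permMatrix_apply,
    Matrix.one_apply]
  rcases Perm.disjoint_iff_eq_or_eq.mp hd x with hx | hx
  · simp [hx]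
  · have : h (g x) = g x := by
      have := congrArg (fun f : Perm V => f x) hd.commute.eq
      simp only [Perm.mul_apply, hx] at this
      exact this.symm
    simp [hx, this, add_comm]

theorem Equiv.Perm.Disjoint.charpoly_permMatrix_mul {g h : Perm V} (hd : g.Disjoint h) :
    (Polynomial.X - 1) ^ Fintype.card V * ((g * h).permMatrix ℚ).charpoly =
      (g.permMatrix ℚ).charpoly * (h.permMatrix ℚ).charpoly := by
  rw [hd.commute.eq, Matrix.permMatrix_mul]
  have hadd := congrArg (Polynomial.C.mapMatrix (m := V)) hd.permMatrix_add
  rw [map_add, map_add, map_one, map_mul] at hadd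
  unfold Matrix.charpoly
  rw [← Matrix.det_mul]
  simp only [Matrix.charmatrix, map_mul]
  set a := Polynomial.C.mapMatrix (g.permMatrix ℚ)
  set b := Polynomial.C.mapMatrix (h.permMatrix ℚ)
  set s : Matrix V V (Polynomial ℚ) := Matrix.scalar V Polynomial.X with hs
  have hcomm : a * s = s * a := (Matrix.scalar_commute _ (fun r => Commute.all _ r) a).eq.symm
  have key : (s - a) * (s - b) = (s - 1) * (s - a * b) := by
    have : (s - a) * (s - b) = s * s - s * (a + b) + a * b := by
      rw [mul_add, ← hcomm]; noncomm_ring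
    rw [this, hadd]; noncomm_ring
  have hdet : (s - 1).det = (Polynomial.X - 1) ^ Fintype.card V := by
    rw [hs, ← map_one (Matrix.scalar V), ← map_sub]
    simp
  rw [key, Matrix.det_mul, hdet]

theorem Equiv.Perm.IsCycle.eq_one_or_eq {g π : Perm V} (hg : g.IsCycle)
    (h : ∀ x, π x = x ∨ π x = g x) : π = 1 ∨ π = g := by
  by_cases h1 : π = 1
  · exact Or.inl h1
  right
  obtain ⟨x, hx⟩ : ∃ x, π x ≠ x := by
    by_contra! hcon
    exact h1 (Equiv.ext hcon)
  have hgx : π x = g x := (h x).resolve_left hx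
  have hne : g x ≠ x := hgx ▸ hx
  have hpow : ∀ k : ℕ, π ((g ^ k) x) = g ((g ^ k) x) := by
    intro k
    induction k with
    | zero => simpa using hgx
    | succ k ih =>
      refine (h _).resolve_left fun heq => ?_
      rw [pow_succ', Perm.mul_apply, ← ih] at heq
      have h2 := π.injective heq
      rw [ih, ← Perm.mul_apply, ← pow_succ', pow_succ, Perm.mul_apply] at h2
      exact hne ((g ^ k).injective h2)
  ext y
  by_cases hy : g y = y
  · rcases h y with h' | h' <;> simp [h', hy]
  · obtain ⟨k, rfl⟩ := hg.exists_pow_eq hne hy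
    exact hpow k

theorem Equiv.Perm.IsCycle.charpoly_permMatrix {g : Perm V} (hg : g.IsCycle) :
    (g.permMatrix ℚ).charpoly =
      (Polynomial.X ^ #g.support - 1) * (Polynomial.X - 1) ^ (Fintype.card V - #g.support) := by
  unfold Matrix.charpoly
  rw [← Matrix.det_transpose, Matrix.det_apply']
  have hentry : ∀ x y, (g.permMatrix ℚ).charmatrix x y =
      (if x = y then Polynomial.X else 0) - (if g x = y then 1 else 0) := by
    intro x y
    rw [Matrix.charmatrix_apply, permMatrix_apply, Matrix.diagonal_apply]
    split_ifs <;> simp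
  have hprod : ∀ u v : Polynomial ℚ, ∏ x, (if g x = x then u else v) =
      v ^ #g.support * u ^ (Fintype.card V - #g.support) := by
    intro u v
    have h1 : univ.filter (fun x => g x = x) = g.supportᶜ := by ext; simp
    have h2 : univ.filter (fun x => ¬ g x = x) = g.support := by ext; simp
    rw [Finset.prod_ite, h1, h2, Finset.prod_const, Finset.prod_const, Finset.card_compl, mul_comm]
  rw [Fintype.sum_eq_add 1 g hg.ne_one.symm]
  · have e1 : ∏ i, (g.permMatrix ℚ).charmatrix.transpose ((1 : Perm V) i) i =
        ∏ x, (if g x = x then (Polynomial.X - 1 : Polynomial ℚ) else Polynomial.X) := by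
      refine Finset.prod_congr rfl fun x _ => ?_
      simp only [Matrix.transpose_apply, hentry, Perm.one_apply]
      split_ifs <;> simp
    have e2 : ∏ i, (g.permMatrix ℚ).charmatrix.transpose (g i) i =
        ∏ x, (if g x = x then (Polynomial.X - 1 : Polynomial ℚ) else -1) := by
      refine Finset.prod_congr rfl fun x _ => ?_
      simp only [Matrix.transpose_apply, hentry, eq_comm (a := x)]
      split_ifs <;> simp
    rw [e1, e2, hprod, hprod, hg.sign]
    have : ((-1 : Polynomial ℚ) ^ #g.support) * (-1) ^ #g.support = 1 := by
      rw [← mul_pow]; simp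
    push_cast
    simp only [Perm.sign_one]
    push_cast
    linear_combination (-(Polynomial.X - 1) ^ (Fintype.card V - #g.support)) * this
  · rintro π ⟨h1, h2⟩
    have : ∃ x, ¬ (π x = x ∨ π x = g x) := by
      by_contra! hcon
      exact (hg.eq_one_or_eq hcon).elim h1 h2
    obtain ⟨x, hx⟩ := this
    rw [not_or] at hx
    rw [Finset.prod_eq_zero (Finset.mem_univ x), mul_zero]
    simp [Matrix.transpose_apply, Ne.symm hx.1, Ne.symm hx.2]

theorem charpoly_permMatrix (g : Perm V) :
    (g.permMatrix ℚ).charpoly =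
      (g.partition.parts.map fun m => (Polynomial.X ^ m - 1 : Polynomial ℚ)).prod := by
  rw [Perm.parts_partition, Multiset.map_add, Multiset.prod_add, Multiset.map_replicate,
    Multiset.prod_replicate, pow_one]
  have hX : (Polynomial.X - 1 : Polynomial ℚ) ≠ 0 := by
    simpa using Polynomial.X_sub_C_ne_zero (1 : ℚ)
  induction g using Perm.cycle_induction_on with
  | base_one => simp [Matrix.permMatrix_one, Matrix.charpoly_one]
  | base_cycles g hg => rw [hg.charpoly_permMatrix, hg.cycleType]; simp
  | induction_disjoint g h hd _ ihg ihh =>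
    refine mul_left_cancel₀ (pow_ne_zero (Fintype.card V) hX) ?_
    rw [hd.charpoly_permMatrix_mul, ihg, ihh, hd.cycleType_mul, Multiset.map_add,
      Multiset.prod_add, hd.card_support_mul]
    have hle : #g.support + #h.support ≤ Fintype.card V := by
      rw [← hd.card_support_mul]; exact Finset.card_le_univ _
    have e : (Polynomial.X - 1 : Polynomial ℚ) ^ (Fintype.card V - #g.support) *
        (Polynomial.X - 1) ^ (Fintype.card V - #h.support) =
        (Polynomial.X - 1) ^ Fintype.card V *
          (Polynomial.X - 1) ^ (Fintype.card V - (#g.support + #h.support)) := by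
      rw [← pow_add, ← pow_add]; congr 1; omega
    linear_combination (Multiset.map (fun m => (Polynomial.X ^ m - 1 : Polynomial ℚ))
      g.cycleType).prod * (Multiset.map (fun m => (Polynomial.X ^ m - 1 : Polynomial ℚ))
      h.cycleType).prod * e

theorem centeredPermMatrix_eq (g : Perm V) :
    centeredPermMatrix g = g.permMatrix ℚ +
      Matrix.vecMulVec (fun _ => -(Fintype.card V : ℚ)⁻¹) (fun _ => 1) := by
  ext x y
  simp [centeredPermMatrix, Matrix.vecMulVec_apply, sub_eq_add_neg]

theorem charpoly_centeredPermMatrix_one [Nonempty V] :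
    (centeredPermMatrix (1 : Perm V)).charpoly =
      (Polynomial.X - 1) ^ (Fintype.card V - 1) * Polynomial.X := by
  have h : centeredPermMatrix (1 : Perm V) =
      Matrix.vecMulVec (fun _ => -(Fintype.card V : ℚ)⁻¹) (fun _ => 1) -
        Matrix.scalar V (-1 : ℚ) := by
    rw [centeredPermMatrix_eq, Matrix.permMatrix_one, map_neg, map_one]; abel
  have hdot : ((fun _ : V => -(Fintype.card V : ℚ)⁻¹) ⬝ᵥ fun _ => 1) = -1 := by
    simp [dotProduct]
  rw [h, Matrix.charpoly_sub_scalar, Matrix.charpoly_vecMulVec, hdot]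
  obtain ⟨k, hk⟩ : ∃ k, Fintype.card V = k + 1 := ⟨_, (Nat.succ_pred Fintype.card_ne_zero).symm⟩
  rw [hk]
  simp
  ring

theorem charpoly_centeredPermMatrix [Nonempty V] (g : Perm V) :
    (Polynomial.X - 1) * (centeredPermMatrix g).charpoly =
      Polynomial.X * (g.permMatrix ℚ).charpoly := by
  have hX : (Polynomial.X - 1 : Polynomial ℚ) ≠ 0 := by
    simpa using Polynomial.X_sub_C_ne_zero (1 : ℚ)
  set J : Matrix V V ℚ := Matrix.vecMulVec (fun _ => -(Fintype.card V : ℚ)⁻¹) (fun _ => 1) with hJ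
  have hgJ : g.permMatrix ℚ * J = J := by
    ext x y
    simp [Matrix.mul_apply, hJ, Matrix.vecMulVec_apply]
  have key : (Polynomial.X - 1) ^ Fintype.card V * (centeredPermMatrix g).charpoly =
      (g.permMatrix ℚ).charpoly * (centeredPermMatrix (1 : Perm V)).charpoly := by
    rw [centeredPermMatrix_eq, centeredPermMatrix_eq, Matrix.permMatrix_one, ← hJ]
    replace hgJ := congrArg (Polynomial.C.mapMatrix (m := V)) hgJ
    rw [map_mul] at hgJ
    unfold Matrix.charpoly
    rw [← Matrix.det_mul]
    simp only [Matrix.charmatrix, map_add, map_one]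
    set a := Polynomial.C.mapMatrix (g.permMatrix ℚ)
    set b := Polynomial.C.mapMatrix J
    set s : Matrix V V (Polynomial ℚ) := Matrix.scalar V Polynomial.X with hs
    have hcomm : a * s = s * a := (Matrix.scalar_commute _ (fun r => Commute.all _ r) a).eq.symm
    have h1 : (s - a) * (s - (1 + b)) = (s - 1) * (s - (a + b)) := by
      have : (s - a) * (s - (1 + b)) = s * s - s - s * b - a * s + a + a * b := by noncomm_ring
      rw [this, hcomm, hgJ]; noncomm_ring
    have hdet : (s - 1).det = (Polynomial.X - 1) ^ Fintype.card V := by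
      rw [hs, ← map_one (Matrix.scalar V), ← map_sub]
      simp
    rw [h1, Matrix.det_mul, hdet]
  rw [charpoly_centeredPermMatrix_one] at key
  refine mul_left_cancel₀ (pow_ne_zero (Fintype.card V - 1) hX) ?_
  rw [← mul_assoc, ← pow_succ, Nat.sub_add_cancel Fintype.card_pos, key]
  ring

/-- The polynomial whose coefficients are, up to sign, the values at `g` of the characters of the
exterior powers of the standard representation. -/
noncomputable def hookPoly (g : Perm V) : Polynomial ℚ :=
  (centeredPermMatrix g).charpoly.divX

theorem hookPoly_eq_of_charpoly_eq {g : Perm V} {K : Polynomial ℚ}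
    (h : (centeredPermMatrix g).charpoly = Polynomial.X * K) : hookPoly g = K := by
  ext k
  rw [hookPoly, h, Polynomial.coeff_divX, Polynomial.coeff_X_mul]

theorem exists_charpoly_centeredPermMatrix_eq [Nonempty V] (g : Perm V) :
    ∃ K : Polynomial ℚ, (centeredPermMatrix g).charpoly = Polynomial.X * K ∧
      (Polynomial.X - 1) * K =
        (g.partition.parts.map fun m => (Polynomial.X ^ m - 1 : Polynomial ℚ)).prod ∧
      K.eval 1 = if g.partition.parts = {Fintype.card V} then (Fintype.card V : ℚ) else 0 := by
  have hX : (Polynomial.X - 1 : Polynomial ℚ) ≠ 0 := by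
    simpa using Polynomial.X_sub_C_ne_zero (1 : ℚ)
  have hsum := g.partition.parts_sum
  have hne : g.partition.parts ≠ 0 := by
    intro h0
    rw [h0, Multiset.sum_zero] at hsum
    exact Fintype.card_ne_zero hsum.symm
  obtain ⟨a, ha⟩ := Multiset.exists_mem_of_ne_zero hne
  obtain ⟨t, ht⟩ := Multiset.exists_cons_of_mem ha
  have hQ := charpoly_permMatrix g
  have hC := charpoly_centeredPermMatrix g
  have hgeom := mul_geom_sum (Polynomial.X : Polynomial ℚ) a
  rw [ht] at hsum hQ ⊢
  rw [Multiset.map_cons, Multiset.prod_cons] at hQ ⊢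
  refine ⟨(∑ i ∈ Finset.range a, Polynomial.X ^ i) *
    (t.map fun m => (Polynomial.X ^ m - 1 : Polynomial ℚ)).prod, ?_, ?_, ?_⟩
  · refine mul_left_cancel₀ hX ?_
    rw [hC, hQ, ← hgeom]; ring
  · rw [← hgeom]; ring
  · rw [Polynomial.eval_mul, Polynomial.eval_multiset_prod, Multiset.map_map]
    rcases Multiset.empty_or_exists_mem t with rfl | ⟨b, hb⟩
    · simp only [Multiset.sum_cons, Multiset.sum_zero, add_zero] at hsum
      simp [hsum, Polynomial.eval_finsetSum]
    · have h0 : (Multiset.map ((fun p => Polynomial.eval 1 p) ∘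
          fun m => (Polynomial.X ^ m - 1 : Polynomial ℚ)) t).prod = 0 :=
        Multiset.prod_eq_zero (Multiset.mem_map.mpr ⟨b, hb, by simp⟩)
      have hc : a ::ₘ t ≠ {Fintype.card V} := by
        intro h
        have := congrArg Multiset.card h
        simp only [Multiset.card_cons, Multiset.card_singleton, Nat.add_eq_right,
          Multiset.card_eq_zero] at this
        simp [this] at hb
      rw [h0, if_neg hc, mul_zero]

theorem X_sub_one_mul_hookPoly [Nonempty V] (g : Perm V) :
    (Polynomial.X - 1) * hookPoly g =
      (g.partition.parts.map fun m => (Polynomial.X ^ m - 1 : Polynomial ℚ)).prod := by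
  obtain ⟨K, h1, h2, -⟩ := exists_charpoly_centeredPermMatrix_eq g
  rw [hookPoly_eq_of_charpoly_eq h1, h2]

theorem eval_one_hookPoly [Nonempty V] (g : Perm V) :
    (hookPoly g).eval 1 =
      if g.partition.parts = {Fintype.card V} then (Fintype.card V : ℚ) else 0 := by
  obtain ⟨K, h1, -, h3⟩ := exists_charpoly_centeredPermMatrix_eq g
  rw [hookPoly_eq_of_charpoly_eq h1, h3]

theorem natDegree_hookPoly (g : Perm V) : (hookPoly g).natDegree = Fintype.card V - 1 := by
  rw [hookPoly, Polynomial.natDegree_divX_eq_natDegree_tsub_one,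
    Matrix.charpoly_natDegree_eq_dim]

theorem coeff_hookPoly (g : Perm V) {r : ℕ} (hr : r < Fintype.card V) :
    (hookPoly g).coeff (Fintype.card V - 1 - r) = (-1) ^ r *
      ∑ s ∈ Finset.univ.powersetCard r,
        ((centeredPermMatrix g).submatrix (Subtype.val : s → V) (Subtype.val : s → V)).det := by
  rw [hookPoly, Polynomial.coeff_divX, ← Matrix.charpoly_coeff_eq_sum_minors _ _ hr.le]
  congr 1
  omega

theorem minorSum_comp_equiv {κ : Type*} [Fintype κ] [DecidableEq κ] (c : Perm V → ℚ) (e : κ ≃ ι)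
    (s t : ι → V) : minorSum c (s ∘ e) (t ∘ e) = minorSum c s t := by
  unfold minorSum
  refine Finset.sum_congr rfl fun g _ => ?_
  rw [← Matrix.submatrix_submatrix, Matrix.det_submatrix_equiv_self]

theorem minorSum_self_eq {c : Perm V → ℚ} (hc : ∀ g h, c (h * g * h⁻¹) = c g) {s t : ι → V}
    (hs : Function.Injective s) (ht : Function.Injective t) : minorSum c s s = minorSum c t t := by
  obtain ⟨h, hh⟩ := Perm.exists_extending_pair s t hs ht
  have : t = h ∘ s := by ext x; simp [hh]
  rw [this, minorSum_perm_comp hc]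

theorem minorSum_finset_eq {c : Perm V → ℚ} (hc : ∀ g h, c (h * g * h⁻¹) = c g) {s t : Finset V}
    (h : #s = #t) : minorSum c (Subtype.val : s → V) Subtype.val =
      minorSum c (Subtype.val : t → V) Subtype.val := by
  rw [← minorSum_comp_equiv c (Finset.equivOfCardEq h.symm) (Subtype.val : s → V)]
  exact minorSum_self_eq hc (Subtype.val_injective.comp (Equiv.injective _)) Subtype.val_injective

theorem sum_mul_coeff_hookPoly (c : Perm V → ℚ) {r : ℕ} (hr : r < Fintype.card V) :
    ∑ g, c g * (hookPoly g).coeff (Fintype.card V - 1 - r) = (-1) ^ r *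
      ∑ s ∈ (Finset.univ : Finset V).powersetCard r,
        minorSum c (Subtype.val : s → V) Subtype.val := by
  simp only [coeff_hookPoly _ hr, minorSum]
  rw [Finset.sum_comm, Finset.mul_sum]
  refine Finset.sum_congr rfl fun g _ => ?_
  rw [← Finset.mul_sum]
  ring

theorem sum_sum_mul_coeff_hookPoly {c d : Perm V → ℚ} (hc : ∀ g h, c (h * g * h⁻¹) = c g)
    (hd : ∀ g h, d (h * g * h⁻¹) = d g) {r : ℕ} (hr : r < Fintype.card V) :
    (1 - (r : ℚ) / Fintype.card V) * (Fintype.card V).choose r *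
      ∑ g, ∑ h, c g * d h * (hookPoly (g * h)).coeff (Fintype.card V - 1 - r) =
    (-1) ^ r * (∑ g, c g * (hookPoly g).coeff (Fintype.card V - 1 - r)) *
      ∑ g, d g * (hookPoly g).coeff (Fintype.card V - 1 - r) := by
  obtain ⟨t, -, ht⟩ := Finset.exists_subset_card_eq (s := (Finset.univ : Finset V)) (n := r)
    (by simpa using hr.le)
  have hconst : ∀ f : Perm V → ℚ, (∀ g h, f (h * g * h⁻¹) = f g) →
      ∑ g, f g * (hookPoly g).coeff (Fintype.card V - 1 - r) = (-1) ^ r *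
        ((Fintype.card V).choose r * minorSum f (Subtype.val : t → V) Subtype.val) := by
    intro f hf
    have hs : ∀ s ∈ (Finset.univ : Finset V).powersetCard r,
        minorSum f (Subtype.val : s → V) Subtype.val =
          minorSum f (Subtype.val : t → V) Subtype.val := fun s hs =>
      minorSum_finset_eq hf ((Finset.mem_powersetCard.mp hs).2.trans ht.symm)
    rw [sum_mul_coeff_hookPoly f hr, Finset.sum_congr rfl hs]
    simp
  have hleft : (1 - (r : ℚ) / Fintype.card V) *
      ∑ g, ∑ h, c g * d h * (hookPoly (g * h)).coeff (Fintype.card V - 1 - r) =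
      (-1) ^ r * ((Fintype.card V).choose r * (minorSum c (Subtype.val : t → V) Subtype.val *
        minorSum d (Subtype.val : t → V) Subtype.val)) := by
    have e : ∑ g, ∑ h, c g * d h * (hookPoly (g * h)).coeff (Fintype.card V - 1 - r) =
        (-1) ^ r * ∑ s ∈ (Finset.univ : Finset V).powersetCard r, ∑ g, ∑ h, c g * d h *
          ((centeredPermMatrix (g * h)).submatrix (Subtype.val : s → V) Subtype.val).det := by
      simp only [coeff_hookPoly _ hr, Finset.mul_sum]
      symm
      rw [Finset.sum_comm]
      refine Finset.sum_congr rfl fun g _ => ?_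
      rw [Finset.sum_comm]
      exact Finset.sum_congr rfl fun h _ => Finset.sum_congr rfl fun s _ => by ring
    rw [e, mul_left_comm, Finset.mul_sum]
    congr 1
    have : ∀ s ∈ (Finset.univ : Finset V).powersetCard r,
        (1 - (r : ℚ) / Fintype.card V) * ∑ g, ∑ h, c g * d h *
          ((centeredPermMatrix (g * h)).submatrix (Subtype.val : s → V) Subtype.val).det =
        minorSum c (Subtype.val : t → V) Subtype.val *
          minorSum d (Subtype.val : t → V) Subtype.val := by
      intro s hs
      have hs' := (Finset.mem_powersetCard.mp hs).2
      rw [← minorSum_finset_eq hc (hs'.trans ht.symm), ← minorSum_finset_eq hd (hs'.trans ht.symm),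
        ← sum_sum_minor_mul hc Subtype.val_injective, Fintype.card_coe, hs']
    rw [Finset.sum_congr rfl this]
    simp
  have hsq : ((-1 : ℚ) ^ r) * (-1) ^ r = 1 := by rw [← mul_pow]; simp
  rw [mul_right_comm, hleft, hconst c hc, hconst d hd]
  linear_combination (-(-1) ^ r * ((Fintype.card V).choose r : ℚ) ^ 2 *
    minorSum c (Subtype.val : t → V) Subtype.val *
      minorSum d (Subtype.val : t → V) Subtype.val) * hsq

end Charpoly

section Pairing

/-- The pairing on binary forms of degree `m` in which `a ^ k * b ^ l` is dual to
`a ^ l * b ^ k`. -/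
noncomputable def binaryPairing (m : ℕ) (f g : MvPolynomial (Fin 2) ℚ) : ℚ :=
  ∑ p ∈ Finset.HasAntidiagonal.antidiagonal m, f.coeff (expVec p.1 p.2) * g.coeff (expVec p.2 p.1) *
    (p.1.factorial : ℚ) * (p.2.factorial : ℚ)

theorem expVec_apply_zero (k l : ℕ) : expVec k l 0 = k := by simp [expVec]

theorem expVec_apply_one (k l : ℕ) : expVec k l 1 = l := by simp [expVec]

theorem expVec_succ_left (k l : ℕ) : expVec (k + 1) l = expVec k l + Finsupp.single 0 1 := by
  ext i; fin_cases i <;> simp [expVec]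

theorem expVec_succ_right (k l : ℕ) : expVec k (l + 1) = expVec k l + Finsupp.single 1 1 := by
  ext i; fin_cases i <;> simp [expVec]

theorem binaryPairing_sum_smul_left {ι : Type*} (s : Finset ι) (m : ℕ) (w : ι → ℚ)
    (f : ι → MvPolynomial (Fin 2) ℚ) (g : MvPolynomial (Fin 2) ℚ) :
    binaryPairing m (∑ i ∈ s, w i • f i) g = ∑ i ∈ s, w i * binaryPairing m (f i) g := by
  simp only [binaryPairing, coeff_sum, coeff_smul, smul_eq_mul, Finset.sum_mul, Finset.mul_sum]
  rw [Finset.sum_comm]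
  exact Finset.sum_congr rfl fun _ _ => Finset.sum_congr rfl fun _ _ => by ring

theorem binaryPairing_sum_smul_right {ι : Type*} (s : Finset ι) (m : ℕ) (w : ι → ℚ)
    (f : MvPolynomial (Fin 2) ℚ) (g : ι → MvPolynomial (Fin 2) ℚ) :
    binaryPairing m f (∑ i ∈ s, w i • g i) = ∑ i ∈ s, w i * binaryPairing m f (g i) := by
  simp only [binaryPairing, coeff_sum, coeff_smul, smul_eq_mul, Finset.sum_mul, Finset.mul_sum]
  rw [Finset.sum_comm]
  exact Finset.sum_congr rfl fun _ _ => Finset.sum_congr rfl fun _ _ => by ring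

theorem binaryPairing_smul_left (m : ℕ) (c : ℚ) (f g : MvPolynomial (Fin 2) ℚ) :
    binaryPairing m (c • f) g = c * binaryPairing m f g := by
  simpa using binaryPairing_sum_smul_left {()} m (fun _ => c) (fun _ => f) g

theorem binaryPairing_smul_right (m : ℕ) (c : ℚ) (f g : MvPolynomial (Fin 2) ℚ) :
    binaryPairing m f (c • g) = c * binaryPairing m f g := by
  simpa using binaryPairing_sum_smul_right {()} m (fun _ => c) f (fun _ => g)

theorem coeff_expVec_zero_left_X_mul (l : ℕ) (f : MvPolynomial (Fin 2) ℚ) :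
    (X 0 * f).coeff (expVec 0 l) = 0 := by
  rw [coeff_X_mul', if_neg (by simp [expVec])]

theorem coeff_expVec_zero_right_X_mul (k : ℕ) (f : MvPolynomial (Fin 2) ℚ) :
    (X 1 * f).coeff (expVec k 0) = 0 := by
  rw [coeff_X_mul', if_neg (by simp [expVec])]

theorem coeff_expVec_succ_left_X_mul (k l : ℕ) (f : MvPolynomial (Fin 2) ℚ) :
    (X 0 * f).coeff (expVec (k + 1) l) = f.coeff (expVec k l) := by
  rw [expVec_succ_left, add_comm, coeff_X_mul]

theorem coeff_expVec_succ_right_X_mul (k l : ℕ) (f : MvPolynomial (Fin 2) ℚ) :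
    (X 1 * f).coeff (expVec k (l + 1)) = f.coeff (expVec k l) := by
  rw [expVec_succ_right, add_comm, coeff_X_mul]

theorem binaryPairing_X_zero_mul (m : ℕ) (f g : MvPolynomial (Fin 2) ℚ) :
    binaryPairing (m + 1) (X 0 * f) g = binaryPairing m f (pderiv 1 g) := by
  unfold binaryPairing
  rw [Finset.Nat.sum_antidiagonal_succ, coeff_expVec_zero_left_X_mul]
  simp only [zero_mul, zero_add]
  refine Finset.sum_congr rfl fun p _ => ?_
  rw [coeff_expVec_succ_left_X_mul, expVec_succ_right, coeff_pderiv, Nat.factorial_succ]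
  rw [expVec_apply_one]
  push_cast
  ring

theorem binaryPairing_X_one_mul (m : ℕ) (f g : MvPolynomial (Fin 2) ℚ) :
    binaryPairing (m + 1) (X 1 * f) g = binaryPairing m f (pderiv 0 g) := by
  unfold binaryPairing
  rw [Finset.Nat.sum_antidiagonal_succ', coeff_expVec_zero_right_X_mul]
  simp only [zero_mul, zero_add]
  refine Finset.sum_congr rfl fun p _ => ?_
  rw [coeff_expVec_succ_right_X_mul, expVec_succ_left, coeff_pderiv, Nat.factorial_succ]
  rw [expVec_apply_zero]
  push_cast
  ring

theorem binaryPairing_add_left (m : ℕ) (f f' g : MvPolynomial (Fin 2) ℚ) :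
    binaryPairing m (f + f') g = binaryPairing m f g + binaryPairing m f' g := by
  simp only [binaryPairing, coeff_add, add_mul, Finset.sum_add_distrib]

theorem binaryPairing_add_right (m : ℕ) (f g g' : MvPolynomial (Fin 2) ℚ) :
    binaryPairing m f (g + g') = binaryPairing m f g + binaryPairing m f g' := by
  simp only [binaryPairing, coeff_add, add_mul, mul_add, Finset.sum_add_distrib]

theorem binaryPairing_add_mul (m : ℕ) (f g : MvPolynomial (Fin 2) ℚ) :
    binaryPairing (m + 1) ((X 0 + X 1) * f) g =
      binaryPairing m f (pderiv 1 g + pderiv 0 g) := by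
  rw [add_mul, binaryPairing_add_left, binaryPairing_add_right, binaryPairing_X_zero_mul,
    binaryPairing_X_one_mul]

theorem binaryPairing_sub_mul (m : ℕ) (f g : MvPolynomial (Fin 2) ℚ) :
    binaryPairing (m + 1) ((X 0 - X 1) * f) g =
      binaryPairing m f (pderiv 1 g + (-1 : ℚ) • pderiv 0 g) := by
  have h : (X 0 - X 1 : MvPolynomial (Fin 2) ℚ) * f = X 0 * f + (-1 : ℚ) • (X 1 * f) := by
    rw [neg_one_smul]; ring
  rw [h, binaryPairing_add_left, binaryPairing_add_right, binaryPairing_smul_left,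
    binaryPairing_smul_right, binaryPairing_X_zero_mul, binaryPairing_X_one_mul]

theorem pderiv_zero_mul_pow (i j : ℕ) :
    pderiv 0 ((X 0 + X 1 : MvPolynomial (Fin 2) ℚ) ^ i * (X 0 - X 1) ^ j) =
      (i : MvPolynomial (Fin 2) ℚ) * (X 0 + X 1) ^ (i - 1) * (X 0 - X 1) ^ j +
        (j : MvPolynomial (Fin 2) ℚ) * (X 0 + X 1) ^ i * (X 0 - X 1) ^ (j - 1) := by
  simp only [pderiv_mul, pderiv_pow, map_add, map_sub, pderiv_X_self,
    pderiv_X_of_ne (show (1 : Fin 2) ≠ 0 by decide)]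
  ring

theorem pderiv_one_mul_pow (i j : ℕ) :
    pderiv 1 ((X 0 + X 1 : MvPolynomial (Fin 2) ℚ) ^ i * (X 0 - X 1) ^ j) =
      (i : MvPolynomial (Fin 2) ℚ) * (X 0 + X 1) ^ (i - 1) * (X 0 - X 1) ^ j -
        (j : MvPolynomial (Fin 2) ℚ) * (X 0 + X 1) ^ i * (X 0 - X 1) ^ (j - 1) := by
  simp only [pderiv_mul, pderiv_pow, map_add, map_sub, pderiv_X_self,
    pderiv_X_of_ne (show (0 : Fin 2) ≠ 1 by decide)]
  ring

theorem binaryPairing_add_mul_pow (m i j : ℕ) (f : MvPolynomial (Fin 2) ℚ) :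
    binaryPairing (m + 1) ((X 0 + X 1) * f) ((X 0 + X 1) ^ i * (X 0 - X 1) ^ j) =
      2 * i * binaryPairing m f ((X 0 + X 1) ^ (i - 1) * (X 0 - X 1) ^ j) := by
  rw [binaryPairing_add_mul, pderiv_zero_mul_pow, pderiv_one_mul_pow, ← binaryPairing_smul_right]
  congr 1
  rw [smul_eq_C_mul]
  simp only [map_mul, map_natCast, map_ofNat]
  ring

theorem binaryPairing_sub_mul_pow (m i j : ℕ) (f : MvPolynomial (Fin 2) ℚ) :
    binaryPairing (m + 1) ((X 0 - X 1) * f) ((X 0 + X 1) ^ i * (X 0 - X 1) ^ j) =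
      -2 * j * binaryPairing m f ((X 0 + X 1) ^ i * (X 0 - X 1) ^ (j - 1)) := by
  rw [binaryPairing_sub_mul, pderiv_zero_mul_pow, pderiv_one_mul_pow, ← binaryPairing_smul_right]
  congr 1
  rw [smul_eq_C_mul, smul_eq_C_mul]
  simp only [map_mul, map_natCast, map_ofNat, map_neg, map_one]
  ring

theorem binaryPairing_pow_mul_pow (m i j i' j' : ℕ) (h : i + j = m) (h' : i' + j' = m) :
    binaryPairing m ((X 0 + X 1) ^ i * (X 0 - X 1) ^ j) ((X 0 + X 1) ^ i' * (X 0 - X 1) ^ j') =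
      if i = i' then (-1) ^ j * 2 ^ m * (i.factorial : ℚ) * (j.factorial : ℚ) else 0 := by
  induction m generalizing i j i' j' with
  | zero =>
    obtain ⟨rfl, rfl⟩ : i = 0 ∧ j = 0 := by omega
    obtain ⟨rfl, rfl⟩ : i' = 0 ∧ j' = 0 := by omega
    have : expVec 0 0 = 0 := by ext; simp [expVec]
    simp [binaryPairing, this]
  | succ m ih =>
    rcases i with _ | i
    · obtain rfl : j = m + 1 := by omega
      have e : (X 0 + X 1 : MvPolynomial (Fin 2) ℚ) ^ 0 * (X 0 - X 1) ^ (m + 1) =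
          (X 0 - X 1) * ((X 0 + X 1) ^ 0 * (X 0 - X 1) ^ m) := by ring
      rw [e, binaryPairing_sub_mul_pow]
      rcases j' with _ | j'
      · rw [if_neg (by omega)]; simp
      · rw [Nat.add_sub_cancel, ih 0 m i' j' (by omega) (by omega)]
        split_ifs with h0
        · obtain rfl : j' = m := by omega
          rw [Nat.factorial_succ]
          push_cast
          ring
        · simp
    · have e : (X 0 + X 1 : MvPolynomial (Fin 2) ℚ) ^ (i + 1) * (X 0 - X 1) ^ j =
          (X 0 + X 1) * ((X 0 + X 1) ^ i * (X 0 - X 1) ^ j) := by ring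
      rw [e, binaryPairing_add_mul_pow]
      rcases i' with _ | i'
      · simp
      · rw [Nat.add_sub_cancel, ih i j i' j' (by omega) (by omega)]
        by_cases h0 : i = i'
        · subst h0
          rw [if_pos rfl, if_pos rfl, Nat.factorial_succ]
          push_cast
          ring
        · rw [if_neg h0, if_neg (by omega), mul_zero]

theorem binaryPairing_sum_pow (m : ℕ) (v w : ℕ → ℚ) :
    binaryPairing m
      (∑ k ∈ Finset.range (m + 1), v k • ((X 0 + X 1) ^ k * (X 0 - X 1) ^ (m - k)))
      (∑ k ∈ Finset.range (m + 1), w k • ((X 0 + X 1) ^ k * (X 0 - X 1) ^ (m - k))) =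
    2 ^ m * ∑ k ∈ Finset.range (m + 1),
      (-1) ^ (m - k) * v k * w k * (k.factorial : ℚ) * ((m - k).factorial : ℚ) := by
  rw [binaryPairing_sum_smul_left, Finset.mul_sum]
  refine Finset.sum_congr rfl fun k hk => ?_
  have hk' := Finset.mem_range_succ_iff.mp hk
  rw [binaryPairing_sum_smul_right]
  have : ∀ l ∈ Finset.range (m + 1), w l * binaryPairing m
      ((X 0 + X 1) ^ k * (X 0 - X 1) ^ (m - k)) ((X 0 + X 1) ^ l * (X 0 - X 1) ^ (m - l)) =
      if k = l then w l * ((-1) ^ (m - k) * 2 ^ m * (k.factorial : ℚ) * ((m - k).factorial : ℚ))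
        else 0 := by
    intro l hl
    have hl' := Finset.mem_range_succ_iff.mp hl
    rw [binaryPairing_pow_mul_pow m k (m - k) l (m - l) (by omega) (by omega), mul_ite, mul_zero]
  rw [Finset.sum_congr rfl this, Finset.sum_ite_eq, if_pos hk]
  ring

theorem coeff_pow_sub_pow_nonneg (i : ℕ) (d : Fin 2 →₀ ℕ) :
    0 ≤ ((X 0 + X 1 : MvPolynomial (Fin 2) ℚ) ^ i - (X 0 - X 1) ^ i).coeff d := by
  suffices h : (∀ d, 0 ≤ ((X 0 + X 1 : MvPolynomial (Fin 2) ℚ) ^ i - (X 0 - X 1) ^ i).coeff d) ∧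
      ∀ d, 0 ≤ ((X 0 + X 1 : MvPolynomial (Fin 2) ℚ) ^ i + (X 0 - X 1) ^ i).coeff d from h.1 d
  have hX : ∀ (j : Fin 2) (p : MvPolynomial (Fin 2) ℚ), (∀ d, 0 ≤ p.coeff d) →
      ∀ d, 0 ≤ (X j * p).coeff d := by
    intro j p hp d
    rw [coeff_X_mul']
    split_ifs
    · exact hp _
    · exact le_rfl
  induction i with
  | zero =>
    refine ⟨by simp, fun d => ?_⟩
    simp only [pow_zero, coeff_add, coeff_one]
    split_ifs <;> norm_num
  | succ i ih =>
    constructor <;> intro d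
    · have e : (X 0 + X 1 : MvPolynomial (Fin 2) ℚ) ^ (i + 1) - (X 0 - X 1) ^ (i + 1) =
          X 0 * ((X 0 + X 1) ^ i - (X 0 - X 1) ^ i) +
            X 1 * ((X 0 + X 1) ^ i + (X 0 - X 1) ^ i) := by ring
      rw [e, coeff_add]
      exact add_nonneg (hX _ _ ih.1 _) (hX _ _ ih.2 _)
    · have e : (X 0 + X 1 : MvPolynomial (Fin 2) ℚ) ^ (i + 1) + (X 0 - X 1) ^ (i + 1) =
          X 0 * ((X 0 + X 1) ^ i + (X 0 - X 1) ^ i) +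
            X 1 * ((X 0 + X 1) ^ i - (X 0 - X 1) ^ i) := by ring
      rw [e, coeff_add]
      exact add_nonneg (hX _ _ ih.2 _) (hX _ _ ih.1 _)

theorem coeff_multiset_prod_nonneg {σ : Type*} {s : Multiset (MvPolynomial σ ℚ)}
    (h : ∀ p ∈ s, ∀ d, 0 ≤ p.coeff d) (d : σ →₀ ℕ) : 0 ≤ s.prod.coeff d := by
  classical
  induction s using Multiset.induction_on generalizing d with
  | empty => rw [Multiset.prod_zero, coeff_one]; split_ifs <;> norm_num
  | cons p s ih =>
    rw [Multiset.prod_cons, coeff_mul]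
    exact Finset.sum_nonneg fun x _ => mul_nonneg (h p (Multiset.mem_cons_self p s) _)
      (ih (fun q hq => h q (Multiset.mem_cons_of_mem hq)) _)

theorem zPart_pos {n : ℕ} (lam : n.Partition) : 0 < zPart lam := by
  refine Finset.prod_pos fun i _ => Nat.mul_pos (Nat.factorial_pos _) ?_
  rcases Nat.eq_zero_or_pos i with rfl | hi
  · have : Multiset.count 0 lam.parts = 0 :=
      Multiset.count_eq_zero_of_notMem fun h => (lam.parts_pos h).false
    simp [this]
  · exact pow_pos hi _

theorem coeff_nonneg_of_mul_eq_prod {n : ℕ} (lam : n.Partition) {R : MvPolynomial (Fin 2) ℚ}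
    (hR : C (zPart lam : ℚ) * X 1 * R =
      (lam.parts.map (fun i => (X 0 + X 1 : MvPolynomial (Fin 2) ℚ) ^ i - (X 0 - X 1) ^ i)).prod)
    (d : Fin 2 →₀ ℕ) : 0 ≤ R.coeff d := by
  have h : 0 ≤ (C (zPart lam : ℚ) * X 1 * R).coeff (Finsupp.single 1 1 + d) := by
    rw [hR]
    refine coeff_multiset_prod_nonneg (fun p hp => ?_) _
    obtain ⟨i, -, rfl⟩ := Multiset.mem_map.mp hp
    exact coeff_pow_sub_pow_nonneg i
  rw [mul_assoc, coeff_C_mul, coeff_X_mul] at h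
  exact nonneg_of_mul_nonneg_right h (by exact_mod_cast zPart_pos lam)

end Pairing

section CycleTypes

theorem card_filter_parts_mul_zPart {n : ℕ} (hn : 0 < n) (lam : n.Partition) :
    #{g : Perm (Fin n) | g.partition.parts = lam.parts} * zPart lam = n.factorial := by
  set m := lam.parts.filter (2 ≤ ·) with hm
  have hparts : lam.parts = m + Multiset.replicate (n - m.sum) 1 := by
    have h1 : lam.parts.filter (¬ 2 ≤ ·) =
        Multiset.replicate (lam.parts.filter (¬ 2 ≤ ·)).card 1 := by
      refine Multiset.eq_replicate_card.mpr fun b hb => ?_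
      have := lam.parts_pos (Multiset.mem_of_mem_filter hb)
      have := Multiset.of_mem_filter hb
      omega
    have h2 : m + lam.parts.filter (¬ 2 ≤ ·) = lam.parts := Multiset.filter_add_not _ _
    have h3 := congrArg Multiset.sum h2
    rw [Multiset.sum_add, lam.parts_sum, h1, Multiset.sum_replicate, smul_eq_mul, mul_one] at h3
    rw [show n - m.sum = (lam.parts.filter (¬ 2 ≤ ·)).card by omega, ← h1, h2]
  have hsum : m.sum ≤ n := by
    have := congrArg Multiset.sum hparts
    rw [Multiset.sum_add, lam.parts_sum] at this
    omega
  have htwo : ∀ a ∈ m, 2 ≤ a := fun a ha => Multiset.of_mem_filter ha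
  have hone : 1 ∉ m := fun h => absurd (htwo 1 h) (by decide)
  have hclass : ∀ g : Perm (Fin n), g.partition.parts = lam.parts ↔ g.cycleType = m := by
    intro g
    constructor
    · intro h
      rw [← Perm.filter_parts_partition_eq_cycleType, hm]
      rw [h]
    · intro h
      rw [Perm.parts_partition, ← Perm.sum_cycleType, h, Fintype.card_fin, ← hparts]
  have hz : zPart lam =
      (n - m.sum).factorial * m.prod * ∏ i ∈ m.toFinset, (m.count i).factorial := by
    have hle : ∀ i ∈ lam.parts, i ∈ Finset.range (n + 1) := fun i hi =>
      Finset.mem_range_succ_iff.mpr (lam.parts_sum ▸ Multiset.single_le_sum (by simp) i hi)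
    have hp : lam.parts.prod = m.prod := by
      rw [hparts, Multiset.prod_add, Multiset.prod_replicate, one_pow, mul_one]
    have hpow : ∏ i ∈ Finset.range (n + 1), i ^ lam.parts.count i = m.prod := by
      rw [← hp, Finset.prod_multiset_count]
      refine (Finset.prod_subset (fun i hi => hle i (Multiset.mem_toFinset.mp hi)) ?_).symm
      intro i _ hi
      rw [Multiset.count_eq_zero_of_notMem (by simpa using hi), pow_zero]
    have hfac : ∏ i ∈ Finset.range (n + 1), (lam.parts.count i).factorial =
        (n - m.sum).factorial * ∏ i ∈ m.toFinset, (m.count i).factorial := by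
      have hone' : 1 ∉ m.toFinset := by simpa using hone
      rw [← Finset.prod_subset (s₁ := insert 1 m.toFinset), Finset.prod_insert hone']
      · congr 1
        · rw [hparts, Multiset.count_add, Multiset.count_eq_zero_of_notMem hone, zero_add,
            Multiset.count_replicate_self]
        · refine Finset.prod_congr rfl fun i hi => ?_
          have : i ≠ 1 := fun h => hone' (h ▸ hi)
          rw [hparts, Multiset.count_add, Multiset.count_replicate, if_neg this.symm, add_zero]
      · intro i hi
        rcases Finset.mem_insert.mp hi with rfl | hi
        · simpa using hn
        · exact hle i (Multiset.mem_of_mem_filter (Multiset.mem_toFinset.mp hi))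
      · intro i _ hi
        rw [Finset.mem_insert, not_or, Multiset.mem_toFinset] at hi
        rw [hparts, Multiset.count_add, Multiset.count_eq_zero_of_notMem hi.2,
          Multiset.count_replicate, if_neg (Ne.symm hi.1)]
        rfl
    rw [zPart, Finset.prod_mul_distrib, hpow, hfac]
    ring
  simp only [hclass]
  have := Perm.card_of_cycleType_mul_eq (Fin n) m
  rw [Fintype.card_fin, if_pos ⟨hsum, htwo⟩] at this
  rw [hz, this]

theorem zPart_indiscrete {n : ℕ} (hn : 0 < n) : zPart (Nat.Partition.indiscrete n) = n := by
  rw [zPart, Nat.Partition.indiscrete_parts hn.ne', Finset.prod_eq_single n]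
  · simp
  · intro i _ hi
    simp [hi]
  · simp

/-- The indicator function of the permutations of cycle type `lam`. -/
def cycleTypeIndicator {n : ℕ} (lam : n.Partition) (g : Perm (Fin n)) : ℚ :=
  if g.partition.parts = lam.parts then 1 else 0

theorem parts_partition_conj {V : Type*} [Fintype V] [DecidableEq V] (g h : Perm V) :
    (h * g * h⁻¹).partition.parts = g.partition.parts := by
  rw [Perm.partition_eq_of_isConj.mp (isConj_iff.mpr ⟨h, rfl⟩ : IsConj g (h * g * h⁻¹))]

theorem cycleTypeIndicator_conj {n : ℕ} (lam : n.Partition) (g h : Perm (Fin n)) :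
    cycleTypeIndicator lam (h * g * h⁻¹) = cycleTypeIndicator lam g := by
  rw [cycleTypeIndicator, cycleTypeIndicator, parts_partition_conj]

theorem sum_cycleTypeIndicator_mul_zPart {n : ℕ} (hn : 0 < n) (lam : n.Partition) :
    (∑ g, cycleTypeIndicator lam g) * zPart lam = n.factorial := by
  simp only [cycleTypeIndicator, Finset.sum_boole]
  exact_mod_cast card_filter_parts_mul_zPart hn lam

theorem numFactorizations_eq_sum {n : ℕ} (lam mu : n.Partition) (σ : Perm (Fin n)) :
    (numFactorizations n lam mu σ : ℚ) =
      ∑ g, ∑ h, cycleTypeIndicator lam g * cycleTypeIndicator mu h *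
        if g * h = σ then 1 else 0 := by
  classical
  rw [numFactorizations, Nat.card_eq_fintype_card, Fintype.card_subtype,
    ← Fintype.sum_prod_type', Finset.card_filter]
  push_cast
  refine Finset.sum_congr rfl fun p _ => ?_
  by_cases h1 : p.1.partition.parts = lam.parts <;>
    by_cases h2 : p.2.partition.parts = mu.parts <;>
    simp [cycleTypeIndicator, hasCycleType, h1, h2]

theorem numFactorizations_conj {n : ℕ} (lam mu : n.Partition) (σ τ : Perm (Fin n)) :
    numFactorizations n lam mu (τ * σ * τ⁻¹) = numFactorizations n lam mu σ := by
  have h : ∀ (g : Perm (Fin n)) (nu : n.Partition),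
      hasCycleType (MulAut.conj τ g) nu ↔ hasCycleType g nu := fun g nu => by
    rw [hasCycleType, hasCycleType, MulAut.conj_apply, parts_partition_conj]
  refine (Nat.card_congr <| (((MulAut.conj τ).toEquiv.prodCongr
    (MulAut.conj τ).toEquiv).subtypeEquiv fun p => ?_)).symm
  refine and_congr (h _ _).symm (and_congr (h _ _).symm ?_)
  rw [← MulAut.conj_apply, ← (MulAut.conj τ).injective.eq_iff, map_mul]
  rfl

theorem numFactorizations_eq_of_parts_eq {n : ℕ} (lam mu : n.Partition) {σ σ' : Perm (Fin n)}
    (h : σ.partition.parts = σ'.partition.parts) :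
    numFactorizations n lam mu σ = numFactorizations n lam mu σ' := by
  obtain ⟨τ, rfl⟩ := isConj_iff.mp (Perm.partition_eq_of_isConj.mpr (Nat.Partition.ext h))
  exact (numFactorizations_conj lam mu σ τ).symm

theorem sum_mul_cycleTypeIndicator {n : ℕ} (lam mu nu : n.Partition) {σ : Perm (Fin n)}
    (hσ : hasCycleType σ nu) :
    ∑ g, ∑ h, cycleTypeIndicator lam g * cycleTypeIndicator mu h * cycleTypeIndicator nu (g * h) =
      (∑ s, cycleTypeIndicator nu s) * numFactorizations n lam mu σ := by
  have h1 : ∀ s, cycleTypeIndicator nu s * (numFactorizations n lam mu σ : ℚ) =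
      cycleTypeIndicator nu s * numFactorizations n lam mu s := by
    intro s
    by_cases hs : s.partition.parts = nu.parts
    · rw [numFactorizations_eq_of_parts_eq lam mu (hs.trans hσ.symm)]
    · rw [cycleTypeIndicator, if_neg hs, zero_mul, zero_mul]
  symm
  rw [Finset.sum_mul, Finset.sum_congr rfl fun s _ => h1 s]
  simp only [numFactorizations_eq_sum, Finset.mul_sum]
  rw [Finset.sum_comm]
  refine Finset.sum_congr rfl fun g _ => ?_
  rw [Finset.sum_comm]
  refine Finset.sum_congr rfl fun h _ => ?_
  simp [mul_comm]

end CycleTypes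

section PositiveFormula

theorem prod_map_div_pow_sub_one_mul_pow_sum (s : Multiset ℕ) (x : ℚ) {y : ℚ} (hy : y ≠ 0) :
    (s.map fun m => (x / y) ^ m - 1).prod * y ^ s.sum = (s.map fun m => x ^ m - y ^ m).prod := by
  induction s using Multiset.induction_on with
  | empty => simp
  | cons m s ih =>
    simp only [Multiset.map_cons, Multiset.prod_cons, Multiset.sum_cons]
    rw [← ih, pow_add, div_pow]
    field_simp

theorem sub_mul_sum_coeff_hookPoly {V : Type*} [Fintype V] [DecidableEq V] [Nonempty V]
    (g : Perm V) (x : ℚ) {y : ℚ} (hy : y ≠ 0) :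
    (x - y) * ∑ k ∈ Finset.range (Fintype.card V),
        (hookPoly g).coeff k * (x ^ k * y ^ (Fintype.card V - 1 - k)) =
      (g.partition.parts.map fun m => x ^ m - y ^ m).prod := by
  have hpos : 0 < Fintype.card V := Fintype.card_pos
  have h := congrArg (Polynomial.eval (x / y)) (X_sub_one_mul_hookPoly g)
  rw [Polynomial.eval_mul, Polynomial.eval_multiset_prod, Multiset.map_map,
    Polynomial.eval_eq_sum_range' (p := hookPoly g) (n := Fintype.card V)
      (by rw [natDegree_hookPoly]; omega)] at h
  simp only [Function.comp_def, Polynomial.eval_sub, Polynomial.eval_pow, Polynomial.eval_X,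
    Polynomial.eval_one] at h
  rw [← prod_map_div_pow_sub_one_mul_pow_sum _ x hy, ← h, g.partition.parts_sum, mul_assoc,
    Finset.sum_mul, Finset.mul_sum, Finset.mul_sum]
  refine Finset.sum_congr rfl fun k hk => ?_
  have hk' := Finset.mem_range.mp hk
  have e : Fintype.card V = k + (Fintype.card V - 1 - k) + 1 := by omega
  have e' : y ^ Fintype.card V = y ^ k * y ^ (Fintype.card V - 1 - k) * y := by
    rw [← pow_add, ← pow_succ, ← e]
  rw [e', div_pow]
  field_simp

theorem zPart_smul_eq_sum {m : ℕ} {lam : (m + 1).Partition} {R : MvPolynomial (Fin 2) ℚ}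
    (hR : C (zPart lam : ℚ) * X 1 * R =
      (lam.parts.map (fun i => (X 0 + X 1 : MvPolynomial (Fin 2) ℚ) ^ i - (X 0 - X 1) ^ i)).prod)
    {g : Perm (Fin (m + 1))} (hg : g.partition.parts = lam.parts) :
    (zPart lam : ℚ) • R = (2 : ℚ) • ∑ k ∈ Finset.range (m + 1),
      (hookPoly g).coeff k • ((X 0 + X 1) ^ k * (X 0 - X 1) ^ (m - k)) := by
  have hX : (X 0 - X 1 : MvPolynomial (Fin 2) ℚ) ≠ 0 :=
    sub_ne_zero.mpr fun h => absurd (X_injective h) (by decide)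
  refine mul_left_cancel₀ (mul_ne_zero (X_ne_zero 1) hX) (MvPolynomial.funext fun v => ?_)
  have h := congrArg (eval v) hR
  rw [map_multiset_prod, Multiset.map_map] at h
  simp only [Function.comp_def, map_mul, map_sub, map_add, map_pow, eval_X, eval_C] at h
  simp only [map_mul, map_sub, map_add, map_pow, eval_X, map_sum, smul_eval]
  by_cases hv : v 0 - v 1 = 0
  · rw [hv, mul_zero, zero_mul, zero_mul]
  · have h' := sub_mul_sum_coeff_hookPoly g (v 0 + v 1) hv
    rw [hg, ← h, Fintype.card_fin] at h'
    simp only [Nat.add_sub_cancel] at h'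
    linear_combination (-(v 0 - v 1)) * h'

theorem factorial_smul_eq_sum {m : ℕ} {lam : (m + 1).Partition} {R : MvPolynomial (Fin 2) ℚ}
    (hR : C (zPart lam : ℚ) * X 1 * R =
      (lam.parts.map (fun i => (X 0 + X 1 : MvPolynomial (Fin 2) ℚ) ^ i - (X 0 - X 1) ^ i)).prod) :
    ((m + 1).factorial : ℚ) • R = (2 : ℚ) • ∑ k ∈ Finset.range (m + 1),
      (∑ g, cycleTypeIndicator lam g * (hookPoly g).coeff k) •
        ((X 0 + X 1) ^ k * (X 0 - X 1) ^ (m - k)) := by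
  have h : ∀ g, cycleTypeIndicator lam g • ((zPart lam : ℚ) • R) = cycleTypeIndicator lam g •
      ((2 : ℚ) • ∑ k ∈ Finset.range (m + 1),
        (hookPoly g).coeff k • ((X 0 + X 1) ^ k * (X 0 - X 1) ^ (m - k))) := by
    intro g
    by_cases hg : g.partition.parts = lam.parts
    · rw [zPart_smul_eq_sum hR hg]
    · rw [cycleTypeIndicator, if_neg hg, zero_smul, zero_smul]
  have h' := Finset.sum_congr (rfl : (Finset.univ : Finset (Perm (Fin (m + 1)))) = _)
    fun g _ => h g
  rw [← Finset.sum_smul, smul_smul, sum_cycleTypeIndicator_mul_zPart m.succ_pos] at h'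
  rw [h']
  simp only [Finset.sum_smul, Finset.smul_sum, smul_smul]
  rw [Finset.sum_comm]
  exact Finset.sum_congr rfl fun _ _ => Finset.sum_congr rfl fun _ _ => by congr 1; ring

theorem factorial_mul_sum_sum_mul_coeff_hookPoly {m : ℕ} (lam mu : (m + 1).Partition) {k : ℕ}
    (hk : k ≤ m) :
    (m.factorial : ℚ) * ∑ g, ∑ h, cycleTypeIndicator lam g * cycleTypeIndicator mu h *
        (hookPoly (g * h)).coeff k =
      (-1) ^ (m - k) * (∑ g, cycleTypeIndicator lam g * (hookPoly g).coeff k) *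
        (∑ g, cycleTypeIndicator mu g * (hookPoly g).coeff k) *
          (k.factorial : ℚ) * ((m - k).factorial : ℚ) := by
  obtain ⟨r, rfl⟩ := Nat.exists_eq_add_of_le hk
  have h := sum_sum_mul_coeff_hookPoly (cycleTypeIndicator_conj lam) (cycleTypeIndicator_conj mu)
    (r := r) (by rw [Fintype.card_fin]; omega)
  rw [Fintype.card_fin, Nat.add_sub_cancel, Nat.add_sub_cancel] at h
  rw [Nat.add_sub_cancel_left, mul_assoc _ (k.factorial : ℚ), ← h]
  have h1 : (((k + r).choose r * (k + r + 1) : ℕ) : ℚ) =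
      (((k + r + 1).choose r * (k + 1) : ℕ) : ℚ) := by
    rw [Nat.choose_mul_succ_eq, show k + r + 1 - r = k + 1 by omega]
  have h2 : (((k + r).choose r * r.factorial * k.factorial : ℕ) : ℚ) =
      ((k + r).factorial : ℚ) := by
    have := Nat.choose_mul_factorial_mul_factorial (Nat.le_add_left r k)
    rw [Nat.add_sub_cancel] at this
    rw [this]
  push_cast at h1 h2
  have h3 : (1 - (r : ℚ) / ((k + r + 1 : ℕ) : ℚ)) * ((k + r + 1).choose r : ℚ) =
      (k + r).choose r := by
    have : (k + r + 1 : ℚ) ≠ 0 := by positivity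
    push_cast
    field_simp
    linear_combination -h1
  rw [h3, ← h2]
  ring

theorem sum_coeff_hookPoly {m : ℕ} (g : Perm (Fin (m + 1))) :
    ∑ k ∈ Finset.range (m + 1), (hookPoly g).coeff k =
      (m + 1) * cycleTypeIndicator (Nat.Partition.indiscrete (m + 1)) g := by
  have h := eval_one_hookPoly g
  rw [Polynomial.eval_eq_sum_range' (n := m + 1) (by rw [natDegree_hookPoly]; simp)] at h
  simp only [one_pow, mul_one, Fintype.card_fin] at h
  rw [h, cycleTypeIndicator, Nat.Partition.indiscrete_parts m.succ_ne_zero]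
  push_cast
  rw [mul_ite, mul_one, mul_zero]

theorem factorial_mul_factorial_mul_numFactorizations {m : ℕ} (lam mu : (m + 1).Partition)
    {σ : Perm (Fin (m + 1))} (hσ : hasCycleType σ (Nat.Partition.indiscrete (m + 1))) :
    ((m + 1).factorial : ℚ) * m.factorial * numFactorizations (m + 1) lam mu σ =
      ∑ k ∈ Finset.range (m + 1),
        (-1) ^ (m - k) * (∑ g, cycleTypeIndicator lam g * (hookPoly g).coeff k) *
          (∑ g, cycleTypeIndicator mu g * (hookPoly g).coeff k) *
            (k.factorial : ℚ) * ((m - k).factorial : ℚ) := by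
  rw [Finset.sum_congr rfl fun k hk => (factorial_mul_sum_sum_mul_coeff_hookPoly lam mu
    (Finset.mem_range_succ_iff.mp hk)).symm, ← Finset.mul_sum]
  have h1 : ∑ k ∈ Finset.range (m + 1), ∑ g, ∑ h, cycleTypeIndicator lam g *
      cycleTypeIndicator mu h * (hookPoly (g * h)).coeff k =
      (m + 1) * ∑ g, ∑ h, cycleTypeIndicator lam g * cycleTypeIndicator mu h *
        cycleTypeIndicator (Nat.Partition.indiscrete (m + 1)) (g * h) := by
    rw [Finset.sum_comm, Finset.mul_sum]
    refine Finset.sum_congr rfl fun g _ => ?_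
    rw [Finset.sum_comm, Finset.mul_sum]
    refine Finset.sum_congr rfl fun h _ => ?_
    rw [← Finset.mul_sum, sum_coeff_hookPoly]
    ring
  have h2 := sum_cycleTypeIndicator_mul_zPart m.succ_pos (Nat.Partition.indiscrete (m + 1))
  rw [zPart_indiscrete m.succ_pos] at h2
  push_cast at h2
  rw [h1, sum_mul_cycleTypeIndicator lam mu _ hσ, ← h2]
  ring

end PositiveFormula

/-- the Goupil–Schaeffer formula in positive terms:
`c^n_{λμ} = n 2^{-n-1} Σ_{k+l=n-1} r_λ^{kl} r_μ^{lk} k! l!`, where `r_λ^{kl}` is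
the coefficient of `a^k b^l` in `R_λ = (1/(z_λ b)) ∏_i Q_{λ_i}`; in particular
each term of the sum is nonnegative. -/
theorem numFactorizations_eq_positive_sum (n : ℕ) (hn : 0 < n)
    (lam mu : n.Partition) (σ : Equiv.Perm (Fin n))
    (hσ : hasCycleType σ (Nat.Partition.indiscrete n))
    (Rlam Rmu : MvPolynomial (Fin 2) ℚ)
    (hlam : MvPolynomial.C (zPart lam : ℚ) * MvPolynomial.X 1 * Rlam =
      (lam.parts.map
        (fun i => (MvPolynomial.X 0 + MvPolynomial.X 1 : MvPolynomial (Fin 2) ℚ) ^ i -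
          (MvPolynomial.X 0 - MvPolynomial.X 1) ^ i)).prod)
    (hmu : MvPolynomial.C (zPart mu : ℚ) * MvPolynomial.X 1 * Rmu =
      (mu.parts.map
        (fun i => (MvPolynomial.X 0 + MvPolynomial.X 1 : MvPolynomial (Fin 2) ℚ) ^ i -
          (MvPolynomial.X 0 - MvPolynomial.X 1) ^ i)).prod) :
    (numFactorizations n lam mu σ : ℚ) =
      (n : ℚ) * (2 : ℚ) ^ (-(n : ℤ) - 1) *
        ∑ k ∈ Finset.range n,
          Rlam.coeff (expVec k (n - 1 - k)) * Rmu.coeff (expVec (n - 1 - k) k) *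
            (k.factorial : ℚ) * ((n - 1 - k).factorial : ℚ) ∧
    ∀ k ∈ Finset.range n,
      0 ≤ Rlam.coeff (expVec k (n - 1 - k)) * Rmu.coeff (expVec (n - 1 - k) k) *
            (k.factorial : ℚ) * ((n - 1 - k).factorial : ℚ) := by
  refine ⟨?_, fun k _ => mul_nonneg (mul_nonneg (mul_nonneg
    (coeff_nonneg_of_mul_eq_prod lam hlam _) (coeff_nonneg_of_mul_eq_prod mu hmu _))
      (Nat.cast_nonneg _)) (Nat.cast_nonneg _)⟩
  obtain ⟨m, rfl⟩ := Nat.exists_eq_add_one_of_ne_zero hn.ne'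
  have hsum : ∑ k ∈ Finset.range (m + 1), Rlam.coeff (expVec k (m + 1 - 1 - k)) *
      Rmu.coeff (expVec (m + 1 - 1 - k) k) * (k.factorial : ℚ) *
        ((m + 1 - 1 - k).factorial : ℚ) = binaryPairing m Rlam Rmu := by
    rw [binaryPairing, Finset.Nat.sum_antidiagonal_eq_sum_range_succ_mk]
    rfl
  rw [hsum]
  have h := congrArg₂ (binaryPairing m) (factorial_smul_eq_sum hlam) (factorial_smul_eq_sum hmu)
  rw [binaryPairing_smul_left, binaryPairing_smul_right, binaryPairing_smul_left,
    binaryPairing_smul_right, binaryPairing_sum_pow,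
    ← factorial_mul_factorial_mul_numFactorizations lam mu hσ, Nat.factorial_succ] at h
  have hm : (m.factorial : ℚ) ≠ 0 := by positivity
  have hm' : (m + 1 : ℚ) ≠ 0 := by positivity
  have hpow : (2 : ℚ) ^ (-((m + 1 : ℕ) : ℤ) - 1) = (2 ^ m * 4)⁻¹ := by
    rw [show (-((m + 1 : ℕ) : ℤ) - 1) = -((m + 2 : ℕ) : ℤ) by push_cast; ring, zpow_neg,
      zpow_natCast, pow_add]
    norm_num
  rw [hpow]
  push_cast at h ⊢
  field_simp at h ⊢
  linear_combination -h
end
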